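/- arXiv:2110.04696 — 2 statements merged into one kernel-verified Lean document; each statement's English description precedes it below -/
import Mathlib

section
/- For all sufficiently large n, the following holds: if G is a simple graph on n vertices in which any two cycles have different lengths, and G contains a cycle of length strictly greater than (15/16)·n, then the number of edges of G is at most n + (3/2)·√n. -/
/-- A simple graph has no repeated cycle lengths if any two cycles of the same
length are in fact the same cycle (i.e., have the same edge set). -/
def NoRepeatedCycleLengths {V : Type*} (G : SimpleGraph V) : Prop :=
  ∀ (u v : V) (c₁ : G.Walk u u) (c₂ : G.Walk v v),
    c₁.IsCycle → c₂.IsCycle → c₁.length = c₂.length →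
      {e | e ∈ c₁.edges} = {e | e ∈ c₂.edges}

section Hypergraph

open Finset

variable {α : Type*} [DecidableEq α]

/-- The total weight of the `p`-random subsets of `U` that avoid `Z ⊆ U`. -/
lemma sum_weight_disjoint (U Z : Finset α) (hZ : Z ⊆ U) (p : ℝ) :
    ∑ R ∈ U.powerset, p ^ #R * (1 - p) ^ (#U - #R) * (if Disjoint Z R then 1 else 0)
      = (1 - p) ^ #Z := by
  have h1 : ∑ R ∈ U.powerset, p ^ #R * (1 - p) ^ (#U - #R) * (if Disjoint Z R then 1 else 0)
      = ∑ R ∈ (U \ Z).powerset, p ^ #R * (1 - p) ^ (#U - #R) := by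
    simp only [mul_ite, mul_one, mul_zero]
    rw [← Finset.sum_filter]
    refine Finset.sum_congr ?_ fun _ _ => rfl
    ext R
    simp only [mem_filter, mem_powerset, subset_sdiff, disjoint_comm]
  have h2 : ∀ R ∈ (U \ Z).powerset, p ^ #R * (1 - p) ^ (#U - #R)
      = (1 - p) ^ #Z * (p ^ #R * (1 - p) ^ (#(U \ Z) - #R)) := by
    intro R hR
    have hc := card_sdiff_add_card_eq_card hZ
    have hR' := card_le_card (mem_powerset.1 hR)
    rw [show #U - #R = #Z + (#(U \ Z) - #R) by omega, pow_add]
    ring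
  rw [h1, Finset.sum_congr rfl h2, ← Finset.mul_sum, Finset.sum_pow_mul_eq_add_pow]
  simp

/-- Pairing up intersecting members of a family lets a hitting set of the members missed by `R`
save one point for each pair missed by `R`. -/
lemma exists_hitting_of_pairs (d c : ℕ) (S : Finset (Finset α)) (hne : ∀ A ∈ S, A.Nonempty)
    (hc : ∀ A ∈ S, #A ≤ c)
    (hd : ∀ S' ⊆ S, (∀ A ∈ S', ∀ B ∈ S', A ≠ B → Disjoint A B) → #S' ≤ d) :
    ∃ Zs : List (Finset α), (∀ Z ∈ Zs, #Z ≤ 2 * c ∧ ∃ A ∈ S, ∃ B ∈ S, Z = A ∪ B) ∧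
      #S ≤ d + 2 * Zs.length ∧
      ∀ R : Finset α, ∃ H : Finset α, (∀ A ∈ S, Disjoint A R → ¬ Disjoint A H) ∧
        (#H : ℝ) + (Zs.map fun Z => if Disjoint Z R then (1 : ℝ) else 0).sum
          ≤ ∑ A ∈ S, if Disjoint A R then (1 : ℝ) else 0 := by
  induction hn : #S using Nat.strong_induction_on generalizing S with
  | _ k ih =>
  subst hn
  by_cases hdisj : ∀ A ∈ S, ∀ B ∈ S, A ≠ B → Disjoint A B
  · refine ⟨[], by simp, by simpa using hd S subset_rfl hdisj, fun R => ?_⟩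
    rcases S.eq_empty_or_nonempty with rfl | ⟨A₀, hA₀⟩
    · exact ⟨∅, by simp⟩
    have : Nonempty α := ⟨(hne A₀ hA₀).choose⟩
    choose! x hx using hne
    refine ⟨(S.filter fun A => Disjoint A R).image x, fun A hA hAR => ?_, ?_⟩
    · rw [not_disjoint_iff]
      exact ⟨x A, hx A hA, mem_image_of_mem _ (mem_filter.2 ⟨hA, hAR⟩)⟩
    · rw [← Finset.sum_filter]
      simp only [List.map_nil, List.sum_nil, add_zero, sum_const, nsmul_eq_mul, mul_one]
      exact_mod_cast card_image_le
  · push Not at hdisj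
    obtain ⟨A, hA, B, hB, hAB, hnd⟩ := hdisj
    obtain ⟨y, hyA, hyB⟩ := not_disjoint_iff.1 hnd
    have hBA : B ∈ S.erase A := mem_erase.2 ⟨hAB.symm, hB⟩
    have hcard : #((S.erase A).erase B) + 2 = #S := by
      have h1 := card_erase_add_one hA
      have h2 := card_erase_add_one hBA
      omega
    have hsub : (S.erase A).erase B ⊆ S := (erase_subset _ _).trans (erase_subset _ _)
    obtain ⟨Zs, hZs, hlen, hR⟩ := ih _ (by omega) ((S.erase A).erase B)
      (fun C hC => hne C (hsub hC)) (fun C hC => hc C (hsub hC))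
      (fun S' hS' => hd S' (hS'.trans hsub)) rfl
    refine ⟨(A ∪ B) :: Zs, ?_, by simp only [List.length_cons]; omega, fun R => ?_⟩
    · intro Z hZ
      rcases List.mem_cons.1 hZ with rfl | hZ
      · refine ⟨(card_union_le _ _).trans ?_, A, hA, B, hB, rfl⟩
        have := hc A hA
        have := hc B hB
        omega
      · obtain ⟨h1, C, hC, D, hD, h2⟩ := hZs Z hZ
        exact ⟨h1, C, hsub hC, D, hsub hD, h2⟩
    · obtain ⟨H, hH, hsum⟩ := hR R
      have hS : ∑ A ∈ S, (if Disjoint A R then (1 : ℝ) else 0)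
          = (if Disjoint A R then 1 else 0) + ((if Disjoint B R then 1 else 0)
            + ∑ A ∈ (S.erase A).erase B, if Disjoint A R then (1 : ℝ) else 0) := by
        rw [add_sum_erase _ (fun A => if Disjoint A R then (1 : ℝ) else 0) hBA,
          add_sum_erase _ (fun A => if Disjoint A R then (1 : ℝ) else 0) hA]
      have hdec : ∀ C ∈ S, C = A ∨ C = B ∨ C ∈ (S.erase A).erase B := by
        intro C hC
        simp only [mem_erase]
        tauto
      simp only [List.map_cons, List.sum_cons, disjoint_union_left]
      rw [hS]
      by_cases h : Disjoint A R ∨ Disjoint B R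
      · refine ⟨insert y H, fun C hC hCR => ?_, ?_⟩
        · rw [not_disjoint_iff]
          rcases hdec C hC with rfl | rfl | hC'
          · exact ⟨y, hyA, mem_insert_self _ _⟩
          · exact ⟨y, hyB, mem_insert_self _ _⟩
          · obtain ⟨z, hz, hz'⟩ := not_disjoint_iff.1 (hH C hC' hCR)
            exact ⟨z, hz, mem_insert_of_mem hz'⟩
        · have : (#(insert y H) : ℝ) ≤ #H + 1 := by exact_mod_cast card_insert_le _ _
          by_cases hA' : Disjoint A R <;> by_cases hB' : Disjoint B R <;>
            simp only [hA', hB', and_true, and_false, and_self, if_true, if_false] <;>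
            first | linarith | (exfalso; tauto)
      · push Not at h
        refine ⟨H, fun C hC hCR => ?_, ?_⟩
        · rcases hdec C hC with rfl | rfl | hC'
          · exact absurd hCR h.1
          · exact absurd hCR h.2
          · exact hH C hC' hCR
        · simp only [h.1, h.2, and_self, if_false]
          linarith

lemma card_mul_card_succ_le_two_mul_sum (T : Finset ℕ) (hT : ∀ t ∈ T, 1 ≤ t) :
    #T * (#T + 1) ≤ 2 * ∑ t ∈ T, t := by
  induction T using Finset.induction_on_max with
  | empty => simp
  | insert a s ha ih =>
    have has : a ∉ s := fun h => lt_irrefl _ (ha a h)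
    rw [card_insert_of_notMem has, sum_insert has]
    have h1 := ih fun t ht => hT t (mem_insert_of_mem ht)
    have h2 : #s + 1 ≤ a := by
      have : insert a s ⊆ Icc 1 a := by
        intro t ht
        refine mem_Icc.2 ⟨hT t ht, ?_⟩
        rcases mem_insert.1 ht with rfl | h
        · exact le_rfl
        · exact (ha t h).le
      have := card_le_card this
      rwa [card_insert_of_notMem has, Nat.card_Icc, Nat.add_sub_cancel] at this
    nlinarith

lemma card_sq_le_of_disjoint_of_card_injOn (U : Finset α) (S : Finset (Finset α))
    (hsub : ∀ A ∈ S, A ⊆ U) (hne : ∀ A ∈ S, A.Nonempty)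
    (hinj : ∀ A ∈ S, ∀ B ∈ S, #A = #B → A = B)
    (hdis : ∀ A ∈ S, ∀ B ∈ S, A ≠ B → Disjoint A B) : #S * #S ≤ 2 * #U := by
  have h1 : #(S.image card) = #S := card_image_of_injOn fun A hA B hB h => hinj A hA B hB h
  have h2 := card_mul_card_succ_le_two_mul_sum (S.image card) (by
    intro t ht
    obtain ⟨A, hA, rfl⟩ := mem_image.1 ht
    exact card_pos.2 (hne A hA))
  rw [h1, sum_image fun A hA B hB h => hinj A hA B hB h] at h2
  have h3 : ∑ A ∈ S, #A ≤ #U := by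
    rw [← card_biUnion fun A hA B hB h => hdis A hA B hB h]
    exact card_le_card (biUnion_subset.2 hsub)
  nlinarith

/-- A family of nonempty sets with distinct cardinalities on at most `(2 * k) ^ 2` points
has a transversal with at most `(2 - 1 / 1000) * (2 * k)` points. -/
lemma exists_transversal (U : Finset α) (k : ℕ) (hk : 1 ≤ k) (hU : #U ≤ (2 * k) ^ 2)
    (𝒜 : Finset (Finset α)) (hsub : ∀ A ∈ 𝒜, A ⊆ U) (hne : ∀ A ∈ 𝒜, A.Nonempty)
    (hinj : ∀ A ∈ 𝒜, ∀ B ∈ 𝒜, #A = #B → A = B) :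
    ∃ F : Finset α, F ⊆ U ∧ (∀ A ∈ 𝒜, ¬ Disjoint A F) ∧
      (#F : ℝ) ≤ (2 - 1 / 1000) * (2 * k) := by
  classical
  set S := 𝒜.filter fun A => #A ≤ 4 * k with hS
  have hSsub : ∀ A ∈ S, A ∈ 𝒜 := fun A hA => (mem_filter.1 hA).1
  obtain ⟨Zs, hZs, hlen, hHit⟩ := exists_hitting_of_pairs (Nat.sqrt (8 * k ^ 2)) (4 * k) S
    (fun A hA => hne A (hSsub A hA)) (fun A hA => (mem_filter.1 hA).2) (by
      intro S' hS' hdis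
      rw [Nat.le_sqrt]
      have := card_sq_le_of_disjoint_of_card_injOn U S' (fun A hA => hsub A (hSsub A (hS' hA)))
        (fun A hA => hne A (hSsub A (hS' hA)))
        (fun A hA B hB => hinj A (hSsub A (hS' hA)) B (hSsub B (hS' hB))) hdis
      nlinarith)
  have hL : ∀ R : Finset α, ∃ H : Finset α, (∀ A ∈ 𝒜, Disjoint A R → ¬ Disjoint A H) ∧
        (#H : ℝ) + (Zs.map fun Z => if Disjoint Z R then (1 : ℝ) else 0).sum
          ≤ ∑ A ∈ 𝒜, if Disjoint A R then (1 : ℝ) else 0 := by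
    intro R
    obtain ⟨H, hH, hsum⟩ := hHit R
    obtain ⟨Zs', -, -, hHit'⟩ := exists_hitting_of_pairs #(𝒜 \ S) (#U) (𝒜 \ S)
      (fun A hA => hne A (mem_sdiff.1 hA).1)
      (fun A hA => card_le_card (hsub A (mem_sdiff.1 hA).1)) (fun S' hS' _ => card_le_card hS')
    obtain ⟨H', hH', hsum'⟩ := hHit' R
    refine ⟨H ∪ H', fun A hA hAR => ?_, ?_⟩
    · rw [disjoint_union_right]
      by_cases h : A ∈ S
      · exact fun h' => hH A h hAR h'.1
      · exact fun h' => hH' A (mem_sdiff.2 ⟨hA, h⟩) hAR h'.2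
    · have h1 : (#(H ∪ H') : ℝ) ≤ #H + #H' := by exact_mod_cast card_union_le _ _
      have h2 := sum_sdiff (f := fun A => if Disjoint A R then (1 : ℝ) else 0)
        (filter_subset (fun A => #A ≤ 4 * k) 𝒜)
      rw [← hS] at h2
      have h3 : 0 ≤ (Zs'.map fun Z => if Disjoint Z R then (1 : ℝ) else 0).sum := by
        apply List.sum_nonneg
        intro x hx
        obtain ⟨Z, -, rfl⟩ := List.mem_map.1 hx
        split_ifs <;> norm_num
      linarith
  choose H hH hsum using hL
  have hkR : (1 : ℝ) ≤ k := by exact_mod_cast hk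
  set p : ℝ := 1 / (2 * k) with hp
  have hp0 : 0 < p := by positivity
  have hp1 : p ≤ 1 / 2 := by
    rw [hp, div_le_div_iff₀ (by positivity) (by norm_num)]
    linarith
  set r : ℝ := 1 - p with hr
  have hr0 : 0 < r := by linarith
  have hr1 : r < 1 := by linarith
  let w : Finset α → ℝ := fun R => p ^ #R * r ^ (#U - #R)
  have hw0 : ∀ R, 0 ≤ w R := fun R => by positivity
  have hw : ∀ Z ⊆ U, ∑ R ∈ U.powerset, w R * (if Disjoint Z R then 1 else 0) = r ^ #Z :=
    fun Z hZ => sum_weight_disjoint U Z hZ p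
  have hw1 : ∑ R ∈ U.powerset, w R = 1 := by
    have := hw ∅ (empty_subset _)
    simpa using this
  have hcardR : ∑ R ∈ U.powerset, w R * #R = p * #U := by
    have h1 : ∀ R ∈ U.powerset, w R * #R
        = w R * #U - ∑ x ∈ U, w R * (if Disjoint {x} R then 1 else 0) := by
      intro R hR
      rw [← Finset.mul_sum, ← mul_sub]
      congr 1
      have h2 : ∑ x ∈ U, (if Disjoint {x} R then (1 : ℝ) else 0) = #(U \ R) := by
        simp only [disjoint_singleton_left]
        rw [← Finset.sum_filter, filter_notMem_eq_sdiff]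
        simp
      have h3 := card_sdiff_add_card_eq_card (mem_powerset.1 hR)
      rw [h2, eq_sub_iff_add_eq, add_comm]
      exact_mod_cast h3
    rw [Finset.sum_congr rfl h1, Finset.sum_sub_distrib, ← Finset.sum_mul, hw1,
      Finset.sum_comm, Finset.sum_congr rfl fun x hx => hw {x} (singleton_subset_iff.2 hx)]
    simp only [card_singleton, pow_one, sum_const, nsmul_eq_mul, hr]
    ring
  have hlist : ∀ Zs : List (Finset α), (∀ Z ∈ Zs, Z ⊆ U ∧ #Z ≤ 8 * k) →
      Zs.length * r ^ (8 * k) ≤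
      ∑ R ∈ U.powerset, w R * (Zs.map fun Z => if Disjoint Z R then (1 : ℝ) else 0).sum := by
    intro Zs hZs
    induction Zs with
    | nil => simp
    | cons Z Zs ih =>
      have h1 := ih fun Z' hZ' => hZs Z' (List.mem_cons_of_mem _ hZ')
      obtain ⟨h2, h3⟩ := hZs Z List.mem_cons_self
      simp only [List.map_cons, List.sum_cons, mul_add, sum_add_distrib, hw Z h2,
        List.length_cons]
      have h4 : r ^ (8 * k) ≤ r ^ #Z := pow_le_pow_of_le_one hr0.le hr1.le h3
      push_cast
      linarith
  have hZsum := hlist Zs (by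
    intro Z hZ
    obtain ⟨h1, A, hA, B, hB, rfl⟩ := hZs Z hZ
    exact ⟨union_subset (hsub A (hSsub A hA)) (hsub B (hSsub B hB)), by omega⟩)
  have hAsum : ∑ R ∈ U.powerset, w R * ∑ A ∈ 𝒜, (if Disjoint A R then (1 : ℝ) else 0)
      = ∑ A ∈ 𝒜, r ^ #A := by
    simp only [Finset.mul_sum]
    rw [Finset.sum_comm]
    exact Finset.sum_congr rfl fun A hA => hw A (hsub A hA)
  have hgeo : ∑ A ∈ 𝒜, r ^ #A + (4 * k - #S) * r ^ (8 * k) ≤ 2 * k := by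
    have h1 : ∑ A ∈ 𝒜, r ^ #A = ∑ i ∈ 𝒜.image card, r ^ i :=
      (sum_image fun A hA B hB h => hinj A hA B hB h).symm
    have h2 : 4 * k ≤ #(Icc 1 (4 * k) \ 𝒜.image card) + #S := by
      have h3 : #(Icc 1 (4 * k) ∩ 𝒜.image card) ≤ #S := by
        refine (card_le_card ?_).trans (card_image_le (f := card))
        intro i hi
        obtain ⟨h4, h5⟩ := mem_inter.1 hi
        obtain ⟨A, hA, rfl⟩ := mem_image.1 h5
        exact mem_image_of_mem _ (mem_filter.2 ⟨hA, (mem_Icc.1 h4).2⟩)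
      have h4 := card_sdiff_add_card_inter (Icc 1 (4 * k)) (𝒜.image card)
      rw [Nat.card_Icc] at h4
      omega
    have h3 : (#(Icc 1 (4 * k) \ 𝒜.image card) : ℝ) * r ^ (8 * k)
        ≤ ∑ i ∈ Icc 1 (4 * k) \ 𝒜.image card, r ^ i := by
      rw [← nsmul_eq_mul]
      refine card_nsmul_le_sum _ _ _ fun i hi => pow_le_pow_of_le_one hr0.le hr1.le ?_
      have := (mem_Icc.1 (mem_sdiff.1 hi).1).2
      omega
    have h4 : ∑ i ∈ 𝒜.image card, r ^ i + ∑ i ∈ Icc 1 (4 * k) \ 𝒜.image card, r ^ i ≤ 2 * k := by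
      rw [← sum_union disjoint_sdiff]
      have h5 := (summable_geometric_of_lt_one hr0.le hr1).sum_le_tsum
        (𝒜.image card ∪ Icc 1 (4 * k) \ 𝒜.image card) (fun i _ => by positivity)
      rw [tsum_geometric_of_lt_one hr0.le hr1] at h5
      refine h5.trans (le_of_eq ?_)
      rw [hr, hp]
      field_simp
      ring
    have h5 : (4 * k - #S : ℝ) ≤ #(Icc 1 (4 * k) \ 𝒜.image card) := by
      rw [sub_le_iff_le_add]
      exact_mod_cast h2
    have h6 : 0 < r ^ (8 * k) := by positivity
    nlinarith
  have hr8 : 1 / 256 ≤ r ^ (8 * k) := by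
    have h1 : (1 / 2 : ℝ) ≤ r ^ k := by
      have h2 := one_add_mul_le_pow (show (-2 : ℝ) ≤ -p by linarith) k
      have h3 : (k : ℝ) * p = 1 / 2 := by rw [hp]; field_simp
      calc (1 / 2 : ℝ) = 1 + k * -p := by linarith
        _ ≤ (1 + -p) ^ k := h2
        _ = r ^ k := by rw [hr]; ring_nf
    calc (1 / 256 : ℝ) = (1 / 2) ^ 8 := by norm_num
      _ ≤ (r ^ k) ^ 8 := pow_le_pow_left₀ (by norm_num) h1 8
      _ = r ^ (8 * k) := by rw [← pow_mul, mul_comm]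
  have hd : ((Nat.sqrt (8 * k ^ 2) : ℕ) : ℝ) ≤ 2.829 * k := by
    have h1 : ((Nat.sqrt (8 * k ^ 2) : ℕ) : ℝ) * (Nat.sqrt (8 * k ^ 2) : ℕ) ≤ 8 * k ^ 2 := by
      exact_mod_cast Nat.sqrt_le (8 * k ^ 2)
    nlinarith
  have hfinal : ∃ R ∈ U.powerset, (#R : ℝ) + #(H R) ≤ (2 - 1 / 1000) * (2 * k) := by
    by_contra! hcon
    have h1 : ∑ R ∈ U.powerset, w R * ((2 - 1 / 1000) * (2 * k))
        ≤ ∑ R ∈ U.powerset, w R * (#R + #(H R)) :=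
      sum_le_sum fun R hR => mul_le_mul_of_nonneg_left (hcon R hR).le (hw0 R)
    have h2 : ∑ R ∈ U.powerset, w R * (#R + #(H R) : ℝ)
        ≤ ∑ R ∈ U.powerset, (w R * #R + w R * ∑ A ∈ 𝒜, (if Disjoint A R then (1 : ℝ) else 0)
          - w R * (Zs.map fun Z => if Disjoint Z R then (1 : ℝ) else 0).sum) := by
      refine sum_le_sum fun R _ => ?_
      rw [← mul_add, ← mul_sub]
      refine mul_le_mul_of_nonneg_left ?_ (hw0 R)
      linarith [hsum R]
    rw [← Finset.sum_mul, hw1, one_mul] at h1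
    rw [sum_sub_distrib, sum_add_distrib, hcardR, hAsum] at h2
    have h3 : p * #U ≤ 2 * k := by
      have h4 : (#U : ℝ) ≤ (2 * k) ^ 2 := by exact_mod_cast hU
      calc p * #U ≤ p * (2 * k) ^ 2 := mul_le_mul_of_nonneg_left h4 hp0.le
        _ = 2 * k := by rw [hp]; field_simp
    have h4 : (#S : ℝ) ≤ 2.829 * k + 2 * Zs.length := by
      have : (#S : ℝ) ≤ (Nat.sqrt (8 * k ^ 2) : ℕ) + 2 * Zs.length := by exact_mod_cast hlen
      linarith
    have h5 : (#S : ℝ) ≤ 4 * k := by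
      have h6 : #(S.image card) = #S := card_image_of_injOn fun A hA B hB h =>
        hinj A (hSsub A hA) B (hSsub B hB) h
      have h7 : #(S.image card) ≤ #(Icc 1 (4 * k)) := by
        refine card_le_card fun i hi => ?_
        obtain ⟨A, hA, rfl⟩ := mem_image.1 hi
        exact mem_Icc.2 ⟨card_pos.2 (hne A (hSsub A hA)), (mem_filter.1 hA).2⟩
      rw [h6, Nat.card_Icc, Nat.add_sub_cancel] at h7
      exact_mod_cast h7
    have h6 : (0.5855 * k : ℝ) ≤ (4 * k - #S) + Zs.length := by linarith
    have h7 : 0.5855 * k * (1 / 256) ≤ ((4 * k - #S) + Zs.length) * r ^ (8 * k) :=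
      mul_le_mul h6 hr8 (by norm_num) (by linarith)
    linarith
  obtain ⟨R, hR, hRle⟩ := hfinal
  refine ⟨(R ∪ H R) ∩ U, inter_subset_right, fun A hA hdis => ?_, ?_⟩
  · have h1 : Disjoint A (R ∪ H R) := by
      rw [disjoint_left] at hdis ⊢
      exact fun x hx hx' => hdis hx (mem_inter.2 ⟨hx', hsub A hA hx⟩)
    rw [disjoint_union_right] at h1
    exact hH R A hA h1.1 h1.2
  · have h1 : #((R ∪ H R) ∩ U) ≤ #R + #(H R) :=
      (card_le_card inter_subset_left).trans (card_union_le _ _)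
    have h2 : (#((R ∪ H R) ∩ U) : ℝ) ≤ #R + #(H R) := by exact_mod_cast h1
    linarith

end Hypergraph

section Sidon

open Finset

variable {ι : Type*} [DecidableEq ι]

/-- A function on ordered pairs that determines the underlying unordered pair has fibres with at
most two elements. -/
lemma sum_le_two_mul_of_pair_injOn (P : Finset (ι × ι)) (len : ι × ι → ℕ) (m : ℕ)
    (hinj : ∀ p ∈ P, ∀ q ∈ P, len p = len q → q = p ∨ q = p.swap) :
    ∑ p ∈ P, (m - len p) ≤ m * (m + 1) := by
  have h1 : ∑ p ∈ P, (m - len p) = ∑ p ∈ P with len p ∈ range (m + 1), (m - len p) := by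
    rw [sum_filter]
    refine sum_congr rfl fun p _ => ?_
    split_ifs with h
    · rfl
    · rw [mem_range] at h
      omega
  rw [h1, ← sum_fiberwise_of_maps_to (t := range (m + 1)) (g := len)
    fun p hp => (mem_filter.1 hp).2]
  calc ∑ l ∈ range (m + 1), ∑ p ∈ {p ∈ P | len p ∈ range (m + 1)} with len p = l, (m - len p)
      ≤ ∑ l ∈ range (m + 1), 2 * (m - l) := by
        refine sum_le_sum fun l _ => ?_
        rw [sum_congr rfl fun p hp => by rw [(mem_filter.1 hp).2], sum_const, smul_eq_mul]
        refine Nat.mul_le_mul_right _ ?_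
        rcases (({p ∈ P | len p ∈ range (m + 1)}).filter fun p => len p = l).eq_empty_or_nonempty
          with h | ⟨p, hp⟩
        · rw [h]
          simp
        · refine (card_le_card (t := {p, p.swap}) fun q hq => ?_).trans card_le_two
          simp only [mem_filter] at hp hq
          simpa using hinj p hp.1.1 q hq.1.1 (hp.2.trans hq.2.symm)
    _ = m * (m + 1) := by
        rw [← mul_sum]
        have h2 := sum_range_reflect (fun i => i) (m + 1)
        have h3 := sum_range_id_mul_two (m + 1)
        simp only [Nat.add_sub_cancel] at h2 h3
        rw [h2, mul_comm, h3, mul_comm]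

/-- The window-counting bound for sets of integers most of whose differences, perturbed by small
weights, are distinct. -/
lemma sq_card_mul_le_of_perturbed_sidon (I : Finset ι) (x : ι → ℤ) (h : ι → ℕ) (l u H : ℕ)
    (hx : ∀ i ∈ I, 0 ≤ x i ∧ x i ≤ l) (hh : ∀ i ∈ I, h i ≤ H) (bad : Finset (ι × ι))
    (hinj : ∀ a ∈ I, ∀ b ∈ I, ∀ c ∈ I, ∀ d ∈ I, a ≠ b → c ≠ d → (a, b) ∉ bad → (c, d) ∉ bad →
      (x a - x b).natAbs + h a + h b = (x c - x d).natAbs + h c + h d →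
      (c = a ∧ d = b) ∨ (c = b ∧ d = a)) :
    (#I * u) ^ 2 ≤ (l + u) * (#I * u + (u + 2 * H + 1) ^ 2 + #bad * u) := by
  classical
  set J : Finset ℤ := Ioc (-(u : ℤ)) l with hJ
  have hJc : #J = l + u := by
    rw [hJ, Int.card_Ioc]
    omega
  let inW : ι → ℤ → Prop := fun i j => j ≤ x i ∧ x i < j + u
  let cnt : ι × ι → ℕ := fun p => #{j ∈ J | inW p.1 j ∧ inW p.2 j}
  have hone : ∀ i ∈ I, #{j ∈ J | inW i j} = u := by
    intro i hi
    have : {j ∈ J | inW i j} = Ioc (x i - u) (x i) := by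
      ext j
      have := hx i hi
      simp only [hJ, inW, mem_filter, mem_Ioc]
      omega
    rw [this, Int.card_Ioc]
    omega
  have hcnt : ∀ p, cnt p ≤ u - (x p.1 - x p.2).natAbs := by
    intro p
    have : {j ∈ J | inW p.1 j ∧ inW p.2 j} ⊆
        Ioc (max (x p.1) (x p.2) - u) (min (x p.1) (x p.2)) := by
      intro j
      simp only [inW, mem_filter, mem_Ioc]
      omega
    refine (card_le_card this).trans ?_
    rw [Int.card_Ioc]
    omega
  have hsum1 : ∑ j ∈ J, #{i ∈ I | inW i j} = #I * u := by
    simp only [card_filter]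
    rw [sum_comm, sum_congr rfl fun i hi => (card_filter _ _).symm.trans (hone i hi), sum_const,
      smul_eq_mul]
  have hsum2 : ∑ j ∈ J, #{i ∈ I | inW i j} ^ 2 = ∑ p ∈ I ×ˢ I, cnt p := by
    simp only [cnt, card_filter, sq, sum_mul_sum, sum_product]
    rw [sum_comm]
    refine sum_congr rfl fun a _ => ?_
    rw [sum_comm]
    refine sum_congr rfl fun b _ => sum_congr rfl fun j _ => ?_
    by_cases h1 : inW a j <;> by_cases h2 : inW b j <;> simp [h1, h2]
  have hCS := sq_sum_le_card_mul_sum_sq (s := J) (f := fun j => #{i ∈ I | inW i j})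
  rw [hsum1, hsum2, hJc] at hCS
  refine hCS.trans (Nat.mul_le_mul_left _ ?_)
  set P := {p ∈ I ×ˢ I | p.1 ≠ p.2 ∧ p ∉ bad} with hP
  have hcover : I ×ˢ I ⊆ (I.image fun i => (i, i)) ∪ (P ∪ bad) := by
    rintro ⟨a, b⟩ hab
    simp only [hP, mem_union, mem_image, mem_filter, Prod.mk.injEq]
    by_cases h1 : a = b
    · subst h1
      exact Or.inl ⟨a, (mem_product.1 hab).1, rfl, rfl⟩
    · by_cases h2 : (a, b) ∈ bad
      · tauto
      · tauto
  have h1 : ∑ p ∈ I.image fun i => (i, i), cnt p ≤ #I * u := by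
    refine (sum_le_card_nsmul _ _ u fun p _ => (hcnt p).trans (Nat.sub_le _ _)).trans ?_
    rw [smul_eq_mul]
    exact Nat.mul_le_mul_right _ card_image_le
  have h2 : ∑ p ∈ bad, cnt p ≤ #bad * u :=
    (sum_le_card_nsmul _ _ u fun p _ => (hcnt p).trans (Nat.sub_le _ _)).trans (by simp)
  have h3 : ∑ p ∈ P, cnt p ≤ (u + 2 * H + 1) ^ 2 := by
    have h4 : ∑ p ∈ P, cnt p
        ≤ ∑ p ∈ P, ((u + 2 * H) - ((x p.1 - x p.2).natAbs + h p.1 + h p.2)) := by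
      refine sum_le_sum fun p hp => (hcnt p).trans ?_
      have hp' := mem_product.1 (mem_filter.1 hp).1
      have := hh _ hp'.1
      have := hh _ hp'.2
      omega
    have h5 := sum_le_two_mul_of_pair_injOn P
      (fun p => (x p.1 - x p.2).natAbs + h p.1 + h p.2) (u + 2 * H) (by
        rintro ⟨a, b⟩ hp ⟨c, d⟩ hq hl
        simp only [hP, mem_filter, mem_product] at hp hq
        simpa [Prod.ext_iff] using hinj a hp.1.1 b hp.1.2 c hq.1.1 d hq.1.2 hp.2.1 hq.2.1
          hp.2.2 hq.2.2 hl)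
    nlinarith
  calc ∑ p ∈ I ×ˢ I, cnt p ≤ ∑ p ∈ (I.image fun i => (i, i)) ∪ (P ∪ bad), cnt p :=
        sum_le_sum_of_subset hcover
    _ ≤ ∑ p ∈ I.image fun i => (i, i), cnt p + (∑ p ∈ P, cnt p + ∑ p ∈ bad, cnt p) := by
        have h6 := sum_union_inter (s₁ := I.image fun i => (i, i)) (s₂ := P ∪ bad) (f := cnt)
        have h7 := sum_union_inter (s₁ := P) (s₂ := bad) (f := cnt)
        omega
    _ ≤ _ := by omega

end Sidon

section Ears

open Finset

/-- The ways to order the ends of two crossing intervals and of a third one along a circle so that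
consecutive ends can be joined by three disjoint arcs into a single closed curve. -/
lemma exists_order_of_crossing {p q p' q' a b : ℕ} (h1 : p < p') (h2 : p' < q) (h3 : q < q')
    (hab : a < b) (hne : ¬ (a = p ∧ b = q)) (hne' : ¬ (a = p' ∧ b = q')) :
    (p ≤ p' ∧ p' < q ∧ q ≤ a ∧ a < q' ∧ q' ≤ b) ∨
    (p < p' ∧ p' ≤ a ∧ a < q ∧ q ≤ b ∧ b < q') ∨
    (p ≤ a ∧ a < p' ∧ p' ≤ q ∧ q < q' ∧ q' ≤ b) ∨
    (p ≤ a ∧ a < p' ∧ p' ≤ b ∧ b < q ∧ q ≤ q') ∨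
    (a ≤ p ∧ p < p' ∧ p' ≤ q ∧ q < b ∧ b ≤ q') ∨
    (a ≤ p ∧ p < b ∧ b ≤ p' ∧ p' < q ∧ q ≤ q') ∨
    (p ≤ p' ∧ p' < a ∧ a ≤ q ∧ q < q' ∧ q' ≤ b) ∨
    (p < a ∧ a ≤ p' ∧ p' < q ∧ q ≤ b ∧ b < q') ∨
    (a < p ∧ p ≤ p' ∧ p' < b ∧ b ≤ q ∧ q < q') ∨
    (a ≤ p ∧ p < p' ∧ p' ≤ q ∧ q < q' ∧ q' ≤ b) ∨
    (p < p' ∧ p' ≤ q ∧ q < q' ∧ q' ≤ a ∧ a < b) ∨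
    (p ≤ p' ∧ p' < q ∧ q ≤ a ∧ a < b ∧ b ≤ q') ∨
    (p < p' ∧ p' ≤ a ∧ a < b ∧ b ≤ q ∧ q < q') ∨
    (a < b ∧ b ≤ p ∧ p < p' ∧ p' ≤ q ∧ q < q') ∨
    (p < p' ∧ p' ≤ a ∧ a < q ∧ q ≤ q' ∧ q' < b) ∨
    (p ≤ a ∧ a < b ∧ b ≤ p' ∧ p' < q ∧ q ≤ q') := by
  rcases lt_trichotomy a p with h | h | h <;> rcases lt_trichotomy a p' with h' | h' | h' <;>
    rcases lt_trichotomy a q with i | i | i <;> rcases lt_trichotomy a q' with i' | i' | i' <;>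
    first
    | (exfalso; omega)
    | (rcases lt_trichotomy b p with j | j | j <;> rcases lt_trichotomy b p' with j' | j' | j' <;>
        rcases lt_trichotomy b q with k | k | k <;> rcases lt_trichotomy b q' with k' | k' | k' <;>
        first
        | (exfalso; omega)
        | omega)

/-- The intervals spanned by two pairs of natural numbers are disjoint. -/
def Separated (a b c d : ℕ) : Prop := max a b < min c d ∨ max c d < min a b

variable {K : Type*} [DecidableEq K]

/-- An ear is a colour together with two feet of that colour, in increasing order. -/
def IsEar (colors : Finset K) (feet : K → Finset ℕ) (e : K × ℕ × ℕ) : Prop :=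
  e.1 ∈ colors ∧ e.2.1 ∈ feet e.1 ∧ e.2.2 ∈ feet e.1 ∧ e.2.1 < e.2.2

/-- The two ends of an ear, in some order. -/
def IsEnds (e : K × ℕ × ℕ) (a b : ℕ) : Prop :=
  (a = e.2.1 ∧ b = e.2.2) ∨ (a = e.2.2 ∧ b = e.2.1)

/-- The combinatorial data of a family of ears attached to a cycle with `ℓ` positions, in a graph
in which cycles are determined by their lengths. The relation `cyc S b k` says that there is a cycle
of length `k` which uses the ears in `S`, and which runs through the wrap-around edge if and
only if `b` is true. -/
structure EarSystem (K : Type*) [DecidableEq K] where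
  ℓ : ℕ
  n : ℕ
  colors : Finset K
  feet : K → Finset ℕ
  reg : K → ℕ
  len : K × ℕ × ℕ → ℕ
  cyc : Finset (K × ℕ × ℕ) → Bool → ℕ → Prop
  le : ℓ ≤ n
  feet_lt : ∀ κ ∈ colors, ∀ x ∈ feet κ, x < ℓ
  sum_reg : ∑ κ ∈ colors, reg κ ≤ n
  len_le : ∀ {e}, IsEar colors feet e → len e ≤ reg e.1 + 1
  cyc_le : ∀ {s b k}, cyc s b k → k ≤ n
  cyc_inj : ∀ {s b s' b' k}, cyc s b k → cyc s' b' k → s = s' ∧ b = b'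
  one_inner : ∀ {e}, IsEar colors feet e → cyc {e} false (e.2.2 - e.2.1 + len e)
  one_wrap : ∀ {e}, IsEar colors feet e → cyc {e} true (ℓ - (e.2.2 - e.2.1) + len e)
  two_nested : ∀ {e f}, IsEar colors feet e → IsEar colors feet f → e.1 ≠ f.1 →
    Separated e.2.1 f.2.1 e.2.2 f.2.2 → ∃ b, cyc {e, f} b
      ((max e.2.1 f.2.1 - min e.2.1 f.2.1) + (max e.2.2 f.2.2 - min e.2.2 f.2.2) + len e + len f)
  two_disjoint : ∀ {e f}, IsEar colors feet e → IsEar colors feet f → e.1 ≠ f.1 →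
    e.2.2 ≤ f.2.1 → ∃ b, cyc {e, f} b
      (ℓ - (e.2.2 - e.2.1) - (f.2.2 - f.2.1) + len e + len f)
  three_inner : ∀ {e f g}, IsEar colors feet e → IsEar colors feet f → IsEar colors feet g →
    e.1 ≠ f.1 → f.1 ≠ g.1 → e.1 ≠ g.1 → ∀ {a b a' b' a'' b''}, IsEnds e a b → IsEnds f a' b' →
    IsEnds g a'' b'' → Separated b a' b' a'' → Separated b' a'' b'' a → Separated b'' a b a' →
    ∃ b k, cyc {e, f, g} b k
  three_wrap : ∀ {e f g}, IsEar colors feet e → IsEar colors feet f → IsEar colors feet g →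
    e.1 ≠ f.1 → f.1 ≠ g.1 → e.1 ≠ g.1 → ∀ {a b a' b' a'' b''}, IsEnds e a b → IsEnds f a' b' →
    IsEnds g a'' b'' → Separated b a' b' a'' →
    min a b'' < min (min b a') (min b' a'') → max (max b a') (max b' a'') < max a b'' →
    ∃ b k, cyc {e, f, g} b k

namespace EarSystem

variable (S : EarSystem K)

/-- A triple of ears lies on a common cycle. -/
def Triple (e f g : K × ℕ × ℕ) : Prop := ∃ b k, S.cyc {e, f, g} b k

variable {S}

lemma Triple.perm_132 {e f g : K × ℕ × ℕ} (h : S.Triple e g f) : S.Triple e f g := by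
  obtain ⟨b, k, h⟩ := h
  exact ⟨b, k, by rwa [pair_comm f g]⟩

lemma Triple.perm_213 {e f g : K × ℕ × ℕ} (h : S.Triple f e g) : S.Triple e f g := by
  obtain ⟨b, k, h⟩ := h
  exact ⟨b, k, by rwa [insert_comm e f]⟩

lemma Triple.perm_312 {e f g : K × ℕ × ℕ} (h : S.Triple g e f) : S.Triple e f g :=
  h.perm_213.perm_132

variable {e f g : K × ℕ × ℕ}

lemma triple_of_crossing (he : IsEar S.colors S.feet e) (hf : IsEar S.colors S.feet f)
    (hg : IsEar S.colors S.feet g) (hef : e.1 ≠ f.1) (hfg : f.1 ≠ g.1) (heg : e.1 ≠ g.1)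
    (h1 : e.2.1 < f.2.1) (h2 : f.2.1 < e.2.2) (h3 : e.2.2 < f.2.2) (hne : g.2 ≠ e.2)
    (hne' : g.2 ≠ f.2) : S.Triple e f g := by
  have h4 := hg.2.2.2
  rcases exists_order_of_crossing h1 h2 h3 h4 (fun h => hne (Prod.ext h.1 h.2))
    fun h => hne' (Prod.ext h.1 h.2) with
    h | h | h | h | h | h | h | h | h | h | h | h | h | h | h | h
  · exact Triple.perm_132 <| S.three_inner he hg hf heg hfg.symm hef
      (Or.inl ⟨rfl, rfl⟩) (Or.inl ⟨rfl, rfl⟩) (Or.inr ⟨rfl, rfl⟩)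
      (by unfold Separated; omega) (by unfold Separated; omega) (by unfold Separated; omega)
  · exact Triple.perm_132 <| S.three_wrap he hg hf heg hfg.symm hef
      (Or.inl ⟨rfl, rfl⟩) (Or.inr ⟨rfl, rfl⟩) (Or.inl ⟨rfl, rfl⟩)
      (by unfold Separated; omega) (by omega) (by omega)
  · exact S.three_inner he hf hg hef hfg heg
      (Or.inl ⟨rfl, rfl⟩) (Or.inl ⟨rfl, rfl⟩) (Or.inr ⟨rfl, rfl⟩)
      (by unfold Separated; omega) (by unfold Separated; omega) (by unfold Separated; omega)
  · exact S.three_inner he hf hg hef hfg heg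
      (Or.inl ⟨rfl, rfl⟩) (Or.inr ⟨rfl, rfl⟩) (Or.inr ⟨rfl, rfl⟩)
      (by unfold Separated; omega) (by unfold Separated; omega) (by unfold Separated; omega)
  · exact S.three_inner he hf hg hef hfg heg
      (Or.inl ⟨rfl, rfl⟩) (Or.inl ⟨rfl, rfl⟩) (Or.inr ⟨rfl, rfl⟩)
      (by unfold Separated; omega) (by unfold Separated; omega) (by unfold Separated; omega)
  · exact S.three_inner he hf hg hef hfg heg
      (Or.inl ⟨rfl, rfl⟩) (Or.inr ⟨rfl, rfl⟩) (Or.inr ⟨rfl, rfl⟩)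
      (by unfold Separated; omega) (by unfold Separated; omega) (by unfold Separated; omega)
  · exact Triple.perm_132 <| S.three_inner he hg hf heg hfg.symm hef
      (Or.inl ⟨rfl, rfl⟩) (Or.inl ⟨rfl, rfl⟩) (Or.inr ⟨rfl, rfl⟩)
      (by unfold Separated; omega) (by unfold Separated; omega) (by unfold Separated; omega)
  · exact Triple.perm_132 <| S.three_wrap he hg hf heg hfg.symm hef
      (Or.inl ⟨rfl, rfl⟩) (Or.inr ⟨rfl, rfl⟩) (Or.inl ⟨rfl, rfl⟩)
      (by unfold Separated; omega) (by omega) (by omega)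
  · exact Triple.perm_312 <| S.three_wrap hg he hf heg.symm hef hfg.symm
      (Or.inl ⟨rfl, rfl⟩) (Or.inr ⟨rfl, rfl⟩) (Or.inl ⟨rfl, rfl⟩)
      (by unfold Separated; omega) (by omega) (by omega)
  · exact S.three_inner he hf hg hef hfg heg
      (Or.inl ⟨rfl, rfl⟩) (Or.inl ⟨rfl, rfl⟩) (Or.inr ⟨rfl, rfl⟩)
      (by unfold Separated; omega) (by unfold Separated; omega) (by unfold Separated; omega)
  · exact S.three_wrap he hf hg hef hfg heg
      (Or.inl ⟨rfl, rfl⟩) (Or.inl ⟨rfl, rfl⟩) (Or.inl ⟨rfl, rfl⟩)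
      (by unfold Separated; omega) (by omega) (by omega)
  · exact Triple.perm_132 <| S.three_inner he hg hf heg hfg.symm hef
      (Or.inl ⟨rfl, rfl⟩) (Or.inl ⟨rfl, rfl⟩) (Or.inr ⟨rfl, rfl⟩)
      (by unfold Separated; omega) (by unfold Separated; omega) (by unfold Separated; omega)
  · exact Triple.perm_132 <| S.three_wrap he hg hf heg hfg.symm hef
      (Or.inl ⟨rfl, rfl⟩) (Or.inr ⟨rfl, rfl⟩) (Or.inl ⟨rfl, rfl⟩)
      (by unfold Separated; omega) (by omega) (by omega)
  · exact Triple.perm_312 <| S.three_wrap hg he hf heg.symm hef hfg.symm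
      (Or.inl ⟨rfl, rfl⟩) (Or.inl ⟨rfl, rfl⟩) (Or.inl ⟨rfl, rfl⟩)
      (by unfold Separated; omega) (by omega) (by omega)
  · exact S.three_wrap he hf hg hef hfg heg
      (Or.inl ⟨rfl, rfl⟩) (Or.inr ⟨rfl, rfl⟩) (Or.inl ⟨rfl, rfl⟩)
      (by unfold Separated; omega) (by omega) (by omega)
  · exact S.three_inner he hf hg hef hfg heg
      (Or.inl ⟨rfl, rfl⟩) (Or.inr ⟨rfl, rfl⟩) (Or.inr ⟨rfl, rfl⟩)
      (by unfold Separated; omega) (by unfold Separated; omega) (by unfold Separated; omega)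

lemma triple_of_disjoint (he : IsEar S.colors S.feet e) (hf : IsEar S.colors S.feet f)
    (hg : IsEar S.colors S.feet g) (hef : e.1 ≠ f.1) (hfg : f.1 ≠ g.1) (heg : e.1 ≠ g.1)
    (h1 : e.2.2 ≤ f.2.1) (h2 : f.2.2 ≤ g.2.1) : S.Triple e f g := by
  have := he.2.2.2
  have := hf.2.2.2
  have := hg.2.2.2
  exact S.three_wrap he hf hg hef hfg heg (Or.inl ⟨rfl, rfl⟩) (Or.inl ⟨rfl, rfl⟩)
    (Or.inl ⟨rfl, rfl⟩) (by unfold Separated; omega) (by omega) (by omega)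

lemma triple_of_contains (he : IsEar S.colors S.feet e) (hf : IsEar S.colors S.feet f)
    (hg : IsEar S.colors S.feet g) (hef : e.1 ≠ f.1) (hfg : f.1 ≠ g.1) (heg : e.1 ≠ g.1)
    (h1 : e.2.1 ≤ f.2.1) (h2 : f.2.2 ≤ g.2.1) (h3 : g.2.2 ≤ e.2.2) : S.Triple e f g := by
  have := he.2.2.2
  have := hf.2.2.2
  have := hg.2.2.2
  exact S.three_inner he hf hg hef hfg heg (Or.inr ⟨rfl, rfl⟩) (Or.inl ⟨rfl, rfl⟩)
    (Or.inl ⟨rfl, rfl⟩) (by unfold Separated; omega) (by unfold Separated; omega)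
    (by unfold Separated; omega)

variable (S) in
/-- The position of an ear relative to a reference ear `g`. -/
def coord (g e : K × ℕ × ℕ) : ℤ :=
  if (g.2.1 ≤ e.2.1 ∧ e.2.2 ≤ g.2.2) ∨ (e.2.1 ≤ g.2.1 ∧ g.2.2 ≤ e.2.2) then
    (e.2.2 : ℤ) - e.2.1 else S.ℓ - ((e.2.2 : ℤ) - e.2.1)

lemma cyc_pair_of_not_triple (he : IsEar S.colors S.feet e) (hf : IsEar S.colors S.feet f)
    (hg : IsEar S.colors S.feet g) (hef : e.1 ≠ f.1) (hfg : f.1 ≠ g.1) (heg : e.1 ≠ g.1)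
    (hne : g.2 ≠ e.2) (hne' : g.2 ≠ f.2) (hT : ¬ S.Triple e f g) :
    ∃ b, S.cyc {e, f} b ((S.coord g e - S.coord g f).natAbs + S.len e + S.len f) := by
  have := he.2.2.2
  have := hf.2.2.2
  have := hg.2.2.2
  by_cases hq : f.2 = e.2
  · obtain ⟨b, hb⟩ := S.two_nested he hf hef (by unfold Separated; rw [hq]; omega)
    refine ⟨b, ?_⟩
    convert hb using 1
    simp [coord, hq]
  have T_efg := hT
  have T_egf := fun h : S.Triple e g f => hT h.perm_132
  have T_feg := fun h : S.Triple f e g => hT h.perm_213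
  have T_fge := fun h : S.Triple f g e => hT h.perm_312.perm_312
  have T_gef := fun h : S.Triple g e f => hT h.perm_312
  have T_gfe := fun h : S.Triple g f e => hT h.perm_132.perm_312
  have c1 : ¬ (e.2.1 < f.2.1 ∧ f.2.1 < e.2.2 ∧ e.2.2 < f.2.2) :=
    fun h => T_efg (triple_of_crossing he hf hg hef hfg heg h.1 h.2.1 h.2.2 hne hne')
  have d1 : ¬ (e.2.2 ≤ f.2.1 ∧ f.2.2 ≤ g.2.1) :=
    fun h => T_efg (triple_of_disjoint he hf hg hef hfg heg h.1 h.2)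
  have n1 : ¬ (e.2.1 ≤ f.2.1 ∧ f.2.2 ≤ g.2.1 ∧ g.2.2 ≤ e.2.2) :=
    fun h => T_efg (triple_of_contains he hf hg hef hfg heg h.1 h.2.1 h.2.2)
  have c2 : ¬ (e.2.1 < g.2.1 ∧ g.2.1 < e.2.2 ∧ e.2.2 < g.2.2) :=
    fun h => T_egf (triple_of_crossing he hg hf heg hfg.symm hef h.1 h.2.1 h.2.2 hq hne'.symm)
  have d2 : ¬ (e.2.2 ≤ g.2.1 ∧ g.2.2 ≤ f.2.1) :=
    fun h => T_egf (triple_of_disjoint he hg hf heg hfg.symm hef h.1 h.2)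
  have n2 : ¬ (e.2.1 ≤ g.2.1 ∧ g.2.2 ≤ f.2.1 ∧ f.2.2 ≤ e.2.2) :=
    fun h => T_egf (triple_of_contains he hg hf heg hfg.symm hef h.1 h.2.1 h.2.2)
  have c3 : ¬ (f.2.1 < e.2.1 ∧ e.2.1 < f.2.2 ∧ f.2.2 < e.2.2) :=
    fun h => T_feg (triple_of_crossing hf he hg hef.symm heg hfg h.1 h.2.1 h.2.2 hne' hne)
  have d3 : ¬ (f.2.2 ≤ e.2.1 ∧ e.2.2 ≤ g.2.1) :=
    fun h => T_feg (triple_of_disjoint hf he hg hef.symm heg hfg h.1 h.2)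
  have n3 : ¬ (f.2.1 ≤ e.2.1 ∧ e.2.2 ≤ g.2.1 ∧ g.2.2 ≤ f.2.2) :=
    fun h => T_feg (triple_of_contains hf he hg hef.symm heg hfg h.1 h.2.1 h.2.2)
  have c4 : ¬ (f.2.1 < g.2.1 ∧ g.2.1 < f.2.2 ∧ f.2.2 < g.2.2) :=
    fun h => T_fge (triple_of_crossing hf hg he hfg heg.symm hef.symm h.1 h.2.1 h.2.2
      (Ne.symm hq) hne.symm)
  have d4 : ¬ (f.2.2 ≤ g.2.1 ∧ g.2.2 ≤ e.2.1) :=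
    fun h => T_fge (triple_of_disjoint hf hg he hfg heg.symm hef.symm h.1 h.2)
  have n4 : ¬ (f.2.1 ≤ g.2.1 ∧ g.2.2 ≤ e.2.1 ∧ e.2.2 ≤ f.2.2) :=
    fun h => T_fge (triple_of_contains hf hg he hfg heg.symm hef.symm h.1 h.2.1 h.2.2)
  have c5 : ¬ (g.2.1 < e.2.1 ∧ e.2.1 < g.2.2 ∧ g.2.2 < e.2.2) :=
    fun h => T_gef (triple_of_crossing hg he hf heg.symm hef hfg.symm h.1 h.2.1 h.2.2 hne'.symm hq)
  have d5 : ¬ (g.2.2 ≤ e.2.1 ∧ e.2.2 ≤ f.2.1) :=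
    fun h => T_gef (triple_of_disjoint hg he hf heg.symm hef hfg.symm h.1 h.2)
  have n5 : ¬ (g.2.1 ≤ e.2.1 ∧ e.2.2 ≤ f.2.1 ∧ f.2.2 ≤ g.2.2) :=
    fun h => T_gef (triple_of_contains hg he hf heg.symm hef hfg.symm h.1 h.2.1 h.2.2)
  have c6 : ¬ (g.2.1 < f.2.1 ∧ f.2.1 < g.2.2 ∧ g.2.2 < f.2.2) :=
    fun h => T_gfe (triple_of_crossing hg hf he hfg.symm hef.symm heg.symm h.1 h.2.1 h.2.2
      hne.symm (Ne.symm hq))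
  have d6 : ¬ (g.2.2 ≤ f.2.1 ∧ f.2.2 ≤ e.2.1) :=
    fun h => T_gfe (triple_of_disjoint hg hf he hfg.symm hef.symm heg.symm h.1 h.2)
  have n6 : ¬ (g.2.1 ≤ f.2.1 ∧ f.2.2 ≤ e.2.1 ∧ e.2.2 ≤ g.2.2) :=
    fun h => T_gfe (triple_of_contains hg hf he hfg.symm hef.symm heg.symm h.1 h.2.1 h.2.2)
  by_cases h1 : e.2.2 ≤ f.2.1
  · obtain ⟨b, hb⟩ := S.two_disjoint he hf hef h1
    refine ⟨b, ?_⟩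
    have := S.feet_lt _ hf.1 _ hf.2.2.1
    convert hb using 1
    unfold coord
    split_ifs <;> grind
  by_cases h2 : f.2.2 ≤ e.2.1
  · obtain ⟨b, hb⟩ := S.two_disjoint hf he hef.symm h2
    refine ⟨b, ?_⟩
    have := S.feet_lt _ he.1 _ he.2.2.1
    rw [pair_comm]
    convert hb using 1
    unfold coord
    split_ifs <;> grind
  obtain ⟨b, hb⟩ := S.two_nested he hf hef (by unfold Separated; omega)
  refine ⟨b, ?_⟩
  convert hb using 1
  unfold coord
  split_ifs <;> grind

end EarSystem

end Ears

section EarCounting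

open Finset

variable {K : Type*} [DecidableEq K]

namespace EarSystem

variable (S : EarSystem K)

/-- The ears of a given colour. -/
def earsOf (κ : K) : Finset (K × ℕ × ℕ) :=
  {x ∈ S.feet κ ×ˢ S.feet κ | x.1 < x.2}.image fun x => (κ, x)

/-- All ears. -/
def ears : Finset (K × ℕ × ℕ) := S.colors.biUnion S.earsOf

variable {S}

lemma mem_earsOf {κ : K} {e : K × ℕ × ℕ} :
    e ∈ S.earsOf κ ↔ e.1 = κ ∧ e.2.1 ∈ S.feet κ ∧ e.2.2 ∈ S.feet κ ∧ e.2.1 < e.2.2 := by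
  obtain ⟨c, p, q⟩ := e
  simp only [earsOf, mem_image, mem_filter, mem_product, Prod.mk.injEq, Prod.exists]
  constructor
  · rintro ⟨a, b, h, rfl, rfl, rfl⟩
    tauto
  · rintro ⟨rfl, h⟩
    exact ⟨p, q, by tauto, rfl, rfl, rfl⟩

lemma mem_ears {e : K × ℕ × ℕ} : e ∈ S.ears ↔ IsEar S.colors S.feet e := by
  simp only [ears, mem_biUnion, mem_earsOf, IsEar]
  constructor
  · rintro ⟨κ, h, rfl, h'⟩
    exact ⟨h, h'⟩
  · rintro ⟨h, h'⟩
    exact ⟨e.1, h, rfl, h'⟩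

lemma pairwiseDisjoint_earsOf (C : Finset K) : (C : Set K).PairwiseDisjoint S.earsOf := by
  intro a _ b _ hab
  refine disjoint_left.2 fun e he he' => hab ?_
  rw [← (mem_earsOf.1 he).1, (mem_earsOf.1 he').1]

lemma two_mul_card_earsOf (κ : K) : 2 * #(S.earsOf κ) = #(S.feet κ) * (#(S.feet κ) - 1) := by
  have h1 : #(S.earsOf κ) = #{x ∈ S.feet κ ×ˢ S.feet κ | x.1 < x.2} :=
    card_image_of_injective _ (Prod.mk_right_injective κ)
  have h2 : (S.feet κ).offDiag = {x ∈ S.feet κ ×ˢ S.feet κ | x.1 < x.2} ∪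
      ({x ∈ S.feet κ ×ˢ S.feet κ | x.1 < x.2}.image Prod.swap) := by
    ext ⟨a, b⟩
    simp only [mem_offDiag, mem_union, mem_filter, mem_product, mem_image, Prod.exists,
      Prod.swap_prod_mk, Prod.mk.injEq]
    constructor
    · rintro ⟨ha, hb, hab⟩
      rcases lt_or_gt_of_ne hab with h | h
      · exact Or.inl ⟨⟨ha, hb⟩, h⟩
      · exact Or.inr ⟨b, a, ⟨⟨hb, ha⟩, h⟩, rfl, rfl⟩
    · rintro (⟨⟨ha, hb⟩, h⟩ | ⟨c, d, ⟨⟨hc, hd⟩, h⟩, rfl, rfl⟩)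
      · exact ⟨ha, hb, h.ne⟩
      · exact ⟨hd, hc, h.ne'⟩
  have h3 := congrArg card h2
  rw [card_union_of_disjoint, card_image_of_injective _ Prod.swap_injective, offDiag_card] at h3
  · rw [h1, two_mul, ← h3, Nat.mul_sub_one]
  · refine disjoint_left.2 ?_
    rintro ⟨a, b⟩ h h'
    simp only [mem_filter, mem_image, Prod.exists, Prod.swap_prod_mk, Prod.mk.injEq] at h h'
    obtain ⟨c, d, h', rfl, rfl⟩ := h'
    omega

lemma sq_card_feet_sub_one_le (κ : K) : (#(S.feet κ) - 1) ^ 2 ≤ 2 * #(S.earsOf κ) := by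
  rw [two_mul_card_earsOf, sq]
  exact Nat.mul_le_mul_right _ (Nat.sub_le _ _)

lemma card_feet_sub_one_le (κ : K) : #(S.feet κ) - 1 ≤ #(S.earsOf κ) := by
  have h := two_mul_card_earsOf (S := S) κ
  rcases Nat.lt_or_ge #(S.feet κ) 2 with h2 | h2
  · omega
  · nlinarith

lemma card_le_of_cyc_flag {α : Type*} (P : Finset α) (s : α → Finset (K × ℕ × ℕ) × Bool)
    (hs : Set.InjOn s P) (h : ∀ a ∈ P, ∃ k, S.cyc (s a).1 (s a).2 k) : #P ≤ S.n + 1 := by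
  choose! k hk using h
  rw [← card_range (S.n + 1)]
  refine card_le_card_of_injOn k (fun a ha => ?_) fun a ha b hb hab => hs ha hb ?_
  · simpa using Nat.lt_succ_of_le (S.cyc_le (hk a ha))
  · have h1 := hk a ha
    rw [hab] at h1
    exact Prod.ext_iff.2 (S.cyc_inj h1 (hk b hb))

lemma card_le_of_cyc {α : Type*} (P : Finset α) (s : α → Finset (K × ℕ × ℕ))
    (hs : Set.InjOn s P) (h : ∀ a ∈ P, ∃ b k, S.cyc (s a) b k) : #P ≤ S.n + 1 := by
  choose! b k hk using h
  exact card_le_of_cyc_flag P (fun a => (s a, b a))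
    (fun x hx y hy hxy => hs hx hy (Prod.ext_iff.1 hxy).1) fun a ha => ⟨k a, hk a ha⟩

lemma two_mul_card_earsOf_le {κ : K} (hκ : κ ∈ S.colors) : 2 * #(S.earsOf κ) ≤ S.n + 1 := by
  have := card_le_of_cyc_flag (S := S) (S.earsOf κ ×ˢ (univ : Finset Bool))
    (fun x => ({x.1}, x.2)) (fun x _ y _ hxy => by simpa [Prod.ext_iff] using hxy) (by
      rintro ⟨e, b⟩ he
      have he' : IsEar S.colors S.feet e :=
        mem_ears.1 (mem_biUnion.2 ⟨κ, hκ, (mem_product.1 he).1⟩)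
      cases b
      · exact ⟨_, S.one_inner he'⟩
      · exact ⟨_, S.one_wrap he'⟩)
  rw [card_product, card_univ, Fintype.card_bool] at this
  omega

lemma exists_cyc_pair {e f : K × ℕ × ℕ} (he : IsEar S.colors S.feet e)
    (hf : IsEar S.colors S.feet f) (hef : e.1 ≠ f.1) : ∃ b k, S.cyc {e, f} b k := by
  by_cases h1 : e.2.2 ≤ f.2.1
  · obtain ⟨b, h⟩ := S.two_disjoint he hf hef h1
    exact ⟨b, _, h⟩
  by_cases h2 : f.2.2 ≤ e.2.1
  · obtain ⟨b, h⟩ := S.two_disjoint hf he hef.symm h2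
    rw [pair_comm] at h
    exact ⟨b, _, h⟩
  · have := he.2.2.2
    have := hf.2.2.2
    obtain ⟨b, h⟩ := S.two_nested he hf hef (by unfold Separated; omega)
    exact ⟨b, _, h⟩

lemma eq_of_pair_eq {α : Type*} [DecidableEq α] {a b c d : α} (h : ({a, b} : Finset α) = {c, d}) :
    (c = a ∧ d = b) ∨ (c = b ∧ d = a) := by
  have h1 : c ∈ ({a, b} : Finset α) := by simp [h]
  have h2 : d ∈ ({a, b} : Finset α) := by simp [h]
  have h3 : a ∈ ({c, d} : Finset α) := by simp [← h]
  have h4 : b ∈ ({c, d} : Finset α) := by simp [← h]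
  simp only [mem_insert, mem_singleton] at h1 h2 h3 h4
  grind

lemma card_mul_card_le {E F : Finset (K × ℕ × ℕ)} (hE : E ⊆ S.ears) (hF : F ⊆ S.ears)
    (hEF : ∀ e ∈ E, ∀ f ∈ F, e.1 ≠ f.1) : #E * #F ≤ S.n + 1 := by
  rw [← card_product]
  refine card_le_of_cyc _ (fun x => {x.1, x.2}) ?_ ?_
  · rintro ⟨e, f⟩ h ⟨e', f'⟩ h' hx
    simp only [coe_product, Set.mem_prod, mem_coe] at h h'
    rcases eq_of_pair_eq hx with ⟨h1, h2⟩ | ⟨h1, h2⟩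
    · exact Prod.ext h1.symm h2.symm
    · dsimp only at h1
      subst h1
      exact absurd rfl (hEF _ h'.1 _ h.2)
  · rintro ⟨e, f⟩ h
    rw [mem_product] at h
    exact exists_cyc_pair (mem_ears.1 (hE h.1)) (mem_ears.1 (hF h.2)) (hEF _ h.1 _ h.2)

/-- If one colour has many ears, the number of feet is small. -/
lemma sum_feet_le_of_large {r M : ℕ} (hr : S.n + 1 ≤ r ^ 2) (hr0 : 0 < r) {κ : K}
    (hκ : κ ∈ S.colors) (hM : M * r ≤ #(S.earsOf κ)) :
    M * ∑ i ∈ S.colors, (#(S.feet i) - 1) ≤ M * r + r := by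
  rw [← add_sum_erase _ _ hκ, mul_add]
  refine Nat.add_le_add (Nat.mul_le_mul_left _ ?_) ?_
  · exact Nat.pow_le_pow_iff_left two_ne_zero |>.1 <|
      (sq_card_feet_sub_one_le κ).trans ((two_mul_card_earsOf_le hκ).trans hr)
  · have h1 : #(S.earsOf κ) * #((S.colors.erase κ).biUnion S.earsOf) ≤ S.n + 1 := by
      refine card_mul_card_le (subset_biUnion_of_mem _ hκ)
        (biUnion_subset_biUnion_of_subset_left _ (erase_subset _ _)) fun e he f hf hef => ?_
      obtain ⟨c, hc, hf⟩ := mem_biUnion.1 hf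
      rw [(mem_earsOf.1 he).1, (mem_earsOf.1 hf).1] at hef
      exact (mem_erase.1 hc).1 hef.symm
    rw [card_biUnion (pairwiseDisjoint_earsOf _)] at h1
    have h2 : ∑ i ∈ S.colors.erase κ, (#(S.feet i) - 1) ≤
        ∑ i ∈ S.colors.erase κ, #(S.earsOf i) := sum_le_sum fun i _ => card_feet_sub_one_le i
    set a := ∑ i ∈ S.colors.erase κ, (#(S.feet i) - 1)
    set b := ∑ i ∈ S.colors.erase κ, #(S.earsOf i)
    have h3 : (M * r) * a ≤ r * r :=
      (Nat.mul_le_mul hM h2).trans (h1.trans (hr.trans_eq (sq r)))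
    exact Nat.le_of_mul_le_mul_left (by linarith [h3, mul_comm r (M * a), mul_right_comm M r a]) hr0

lemma exists_subset_sum {α : Type*} [DecidableEq α] (s : Finset α) (w : α → ℕ) {a b : ℕ}
    (hw : ∀ i ∈ s, w i ≤ a) (hb : b ≤ ∑ i ∈ s, w i) :
    ∃ t ⊆ s, b ≤ ∑ i ∈ t, w i ∧ ∑ i ∈ t, w i ≤ b + a := by
  induction s using Finset.induction_on with
  | empty => exact ⟨∅, Subset.rfl, hb, by simp⟩
  | insert i s hi ih =>
    by_cases h : b ≤ ∑ i ∈ s, w i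
    · obtain ⟨t, ht, h⟩ := ih (fun i hi => hw i (mem_insert_of_mem hi)) h
      exact ⟨t, ht.trans (subset_insert _ _), h⟩
    · refine ⟨_, Subset.rfl, hb, ?_⟩
      rw [sum_insert hi]
      have := hw i (mem_insert_self _ _)
      omega

lemma card_ears_le {r M : ℕ} (hr : S.n + 1 ≤ r ^ 2) (hr0 : 0 < r)
    (hM : ∀ κ ∈ S.colors, #(S.earsOf κ) ≤ M * r) : #S.ears ≤ (M + 4) * r := by
  by_contra! h
  rw [ears, card_biUnion (pairwiseDisjoint_earsOf _)] at h
  obtain ⟨t, ht, h1, h2⟩ := exists_subset_sum S.colors (fun κ => #(S.earsOf κ)) (a := M * r)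
    (b := 2 * r) hM (by nlinarith)
  have h3 : #(t.biUnion S.earsOf) * #((S.colors \ t).biUnion S.earsOf) ≤ S.n + 1 := by
    refine card_mul_card_le (biUnion_subset_biUnion_of_subset_left _ ht)
      (biUnion_subset_biUnion_of_subset_left _ sdiff_subset) fun e he f hf hef => ?_
    obtain ⟨c, hc, hf⟩ := mem_biUnion.1 hf
    obtain ⟨d, hd, he⟩ := mem_biUnion.1 he
    rw [(mem_earsOf.1 he).1, (mem_earsOf.1 hf).1] at hef
    exact (mem_sdiff.1 hc).2 (hef ▸ hd)
  rw [card_biUnion (pairwiseDisjoint_earsOf _), card_biUnion (pairwiseDisjoint_earsOf _)] at h3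
  have h4 := sum_sdiff (f := fun κ => #(S.earsOf κ)) ht
  have h5 : 2 * r ≤ ∑ κ ∈ S.colors \ t, #(S.earsOf κ) := by
    rw [add_mul] at h
    omega
  nlinarith [Nat.mul_le_mul h1 h5]

end EarSystem

end EarCounting

section EarSidon

open Finset

variable {K : Type*} [DecidableEq K]

namespace EarSystem

variable {S : EarSystem K}

variable (S) in
open Classical in
/-- The pairs of ears in `I` that lie, together with `g`, on a cycle through three ears. -/
noncomputable def triplePairs (I : Finset (K × ℕ × ℕ)) (g : K × ℕ × ℕ) :
    Finset ((K × ℕ × ℕ) × (K × ℕ × ℕ)) :=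
  {x ∈ I ×ˢ I | S.Triple x.1 x.2 g}

lemma exists_few_triplePairs {I : Finset (K × ℕ × ℕ)} (hI : I.Nonempty) :
    ∃ g ∈ I, #I * #(S.triplePairs I g) ≤ 27 * (S.n + 1) := by
  classical
  set T := I.sigma fun g => S.triplePairs I g with hT
  let sig : (Σ _ : K × ℕ × ℕ, (K × ℕ × ℕ) × (K × ℕ × ℕ)) → Finset (K × ℕ × ℕ) :=
    fun x => {x.2.1, x.2.2, x.1}
  have h1 : #(T.image sig) ≤ S.n + 1 := by
    refine card_le_of_cyc _ id (Set.injOn_id _) fun s hs => ?_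
    obtain ⟨x, hx, rfl⟩ := mem_image.1 hs
    rw [hT, mem_sigma, triplePairs, mem_filter] at hx
    exact hx.2.2
  have h2 : #T ≤ 27 * #(T.image sig) := by
    refine card_le_mul_card_image _ _ fun s hs => ?_
    obtain ⟨x, -, rfl⟩ := mem_image.1 hs
    have h3 : #(sig x) ≤ 3 := card_le_three
    refine (card_le_card_of_injOn (t := sig x ×ˢ sig x ×ˢ sig x)
      (fun y => (y.1, y.2.1, y.2.2)) ?_ ?_).trans ?_
    · intro y hy
      have h4 : sig y = sig x := (mem_filter.1 hy).2
      rw [← h4]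
      simp [sig]
    · rintro ⟨a, b, c⟩ _ ⟨a', b', c'⟩ _ h
      simp only [Prod.mk.injEq] at h
      obtain ⟨rfl, rfl, rfl⟩ := h
      rfl
    · rw [card_product, card_product]
      exact (Nat.mul_le_mul h3 (Nat.mul_le_mul h3 h3)).trans (by norm_num)
  have h3 : ∑ g ∈ I, #I * #(S.triplePairs I g) ≤ ∑ g ∈ I, 27 * (S.n + 1) := by
    rw [← mul_sum, sum_const, smul_eq_mul]
    refine Nat.mul_le_mul_left _ ?_
    rw [← card_sigma]
    exact h2.trans (Nat.mul_le_mul_left _ h1)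
  exact exists_le_of_sum_le hI h3

lemma card_parallel_le {P : Finset (K × ℕ × ℕ)} (hP : P ⊆ S.ears) {H : ℕ}
    (hH : ∀ e ∈ P, S.len e ≤ H) {z : ℕ × ℕ} (hz : ∀ e ∈ P, e.2 = z) :
    #P * (#P - 1) ≤ 2 * (2 * H + 1) := by
  have hcyc : ∀ x ∈ P.offDiag, ∃ b, S.cyc {x.1, x.2} b (S.len x.1 + S.len x.2) := by
    rintro ⟨e, f⟩ h
    obtain ⟨he, hf, hef⟩ := mem_offDiag.1 h
    have he' : IsEar S.colors S.feet e := mem_ears.1 (hP he)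
    have hf' : IsEar S.colors S.feet f := mem_ears.1 (hP hf)
    have h2 : e.2 = f.2 := (hz e he).trans (hz f hf).symm
    have h3 := hf'.2.2.2
    obtain ⟨b, hb⟩ := S.two_nested (e := e) (f := f) he' hf' (fun h => hef (Prod.ext h h2))
      (by unfold Separated; rw [h2]; omega)
    refine ⟨b, ?_⟩
    convert hb using 1
    simp [h2]
  have h1 : #P.offDiag ≤ 2 * #(P.offDiag.image fun x => S.len x.1 + S.len x.2) := by
    refine card_le_mul_card_image _ _ fun k hk => ?_
    obtain ⟨x, hx, rfl⟩ := mem_image.1 hk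
    refine (card_le_card (t := {x, x.swap}) fun y hy => ?_).trans card_le_two
    obtain ⟨hy, hxy⟩ := mem_filter.1 hy
    obtain ⟨b, hb⟩ := hcyc x hx
    obtain ⟨b', hb'⟩ := hcyc y hy
    rw [hxy] at hb'
    simpa [Prod.ext_iff] using eq_of_pair_eq (S.cyc_inj hb hb').1
  have h2 : (P.offDiag.image fun x => S.len x.1 + S.len x.2) ⊆ range (2 * H + 1) := by
    intro k hk
    obtain ⟨x, hx, rfl⟩ := mem_image.1 hk
    have := hH _ (mem_offDiag.1 hx).1
    have := hH _ (mem_offDiag.1 hx).2.1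
    rw [mem_range]
    omega
  have h3 := card_le_card h2
  rw [card_range] at h3
  rw [offDiag_card, ← Nat.mul_sub_one] at h1
  omega

lemma coord_mem_Icc {e g : K × ℕ × ℕ} (he : IsEar S.colors S.feet e) :
    0 ≤ S.coord g e ∧ S.coord g e ≤ S.ℓ := by
  have h1 := S.feet_lt _ he.1 _ he.2.2.1
  have h2 := he.2.2.2
  unfold coord
  split_ifs <;> omega

lemma sq_card_mul_le {I : Finset (K × ℕ × ℕ)} (hI : I ⊆ S.ears) {H : ℕ}
    (hH : ∀ e ∈ I, S.len e ≤ H) {g : K × ℕ × ℕ} (hg : g ∈ S.ears) (u : ℕ) :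
    (#{e ∈ I | e.2 ≠ g.2 ∧ e.1 ≠ g.1} * u) ^ 2 ≤ (S.ℓ + u) *
      (#{e ∈ I | e.2 ≠ g.2 ∧ e.1 ≠ g.1} * u + (u + 2 * H + 1) ^ 2 +
        (#{x ∈ I ×ˢ I | x.1.1 = x.2.1} + #(S.triplePairs I g)) * u) := by
  have hear : ∀ e ∈ I, IsEar S.colors S.feet e := fun e he => mem_ears.1 (hI he)
  have h := sq_card_mul_le_of_perturbed_sidon {e ∈ I | e.2 ≠ g.2 ∧ e.1 ≠ g.1} (S.coord g)
    S.len S.ℓ u H (fun e he => coord_mem_Icc (hear e (mem_filter.1 he).1))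
    (fun e he => hH e (mem_filter.1 he).1)
    ({x ∈ I ×ˢ I | x.1.1 = x.2.1} ∪ S.triplePairs I g) ?_
  · refine h.trans (Nat.mul_le_mul_left _ (Nat.add_le_add_left (Nat.mul_le_mul_right _ ?_) _))
    exact card_union_le _ _
  · have key : ∀ a ∈ ({e ∈ I | e.2 ≠ g.2 ∧ e.1 ≠ g.1} : Finset _),
        ∀ b ∈ ({e ∈ I | e.2 ≠ g.2 ∧ e.1 ≠ g.1} : Finset _),
        (a, b) ∉ {x ∈ I ×ˢ I | x.1.1 = x.2.1} ∪ S.triplePairs I g →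
        ∃ w, S.cyc {a, b} w ((S.coord g a - S.coord g b).natAbs + S.len a + S.len b) := by
      intro a ha b hb hab
      simp only [mem_union, mem_filter, mem_product, triplePairs, not_or] at ha hb hab
      exact cyc_pair_of_not_triple (hear a ha.1) (hear b hb.1) (mem_ears.1 hg)
        (fun h => hab.1 ⟨⟨ha.1, hb.1⟩, h⟩) hb.2.2 ha.2.2 ha.2.1.symm hb.2.1.symm
        (fun h => hab.2 ⟨⟨ha.1, hb.1⟩, h⟩)
    intro a ha b hb c hc d hd _ _ h1 h2 h3
    obtain ⟨w, hw⟩ := key a ha b hb h1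
    obtain ⟨w', hw'⟩ := key c hc d hd h2
    rw [← h3] at hw'
    exact eq_of_pair_eq (S.cyc_inj hw hw').1

end EarSystem

end EarSidon

section EarBound

open Finset

variable {K : Type*} [DecidableEq K]

namespace EarSystem

variable {S : EarSystem K}

lemma card_sameColor_le {I : Finset (K × ℕ × ℕ)} (hI : I ⊆ S.ears)
    (hc : ∀ κ ∈ S.colors, #{e ∈ I | e.1 = κ} ≤ #(S.feet κ) - 1) :
    #{x ∈ I ×ˢ I | x.1.1 = x.2.1} ≤ 2 * #S.ears := by
  have h1 : {x ∈ I ×ˢ I | x.1.1 = x.2.1} ⊆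
      S.colors.biUnion fun κ => {e ∈ I | e.1 = κ} ×ˢ {e ∈ I | e.1 = κ} := by
    rintro ⟨e, f⟩ h
    simp only [mem_filter, mem_product] at h
    simp only [mem_biUnion, mem_product, mem_filter]
    exact ⟨e.1, (mem_ears.1 (hI h.1.1)).1, ⟨h.1.1, rfl⟩, h.1.2, h.2.symm⟩
  refine (card_le_card h1).trans (card_biUnion_le.trans ?_)
  rw [ears, card_biUnion (pairwiseDisjoint_earsOf _), mul_sum]
  refine sum_le_sum fun κ hκ => ?_
  rw [card_product, ← sq]
  exact (Nat.pow_le_pow_left (hc κ hκ) 2).trans (sq_card_feet_sub_one_le κ)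

lemma card_le_filter_add (I : Finset (K × ℕ × ℕ)) (g : K × ℕ × ℕ) :
    #I ≤ #{e ∈ I | e.2 ≠ g.2 ∧ e.1 ≠ g.1} + #{e ∈ I | e.2 = g.2} + #{e ∈ I | e.1 = g.1} := by
  have : I ⊆ {e ∈ I | e.2 ≠ g.2 ∧ e.1 ≠ g.1} ∪ {e ∈ I | e.2 = g.2} ∪ {e ∈ I | e.1 = g.1} := by
    intro e he
    simp only [mem_union, mem_filter]
    tauto
  exact (card_le_card this).trans
    ((card_union_le _ _).trans (Nat.add_le_add_right (card_union_le _ _) _))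

/-- The feet of the colours with a large region are few. -/
lemma sum_feet_large_reg_le {r M B : ℕ} (hr : S.n + 1 ≤ r ^ 2) (hr0 : 0 < r)
    (hW : #S.ears ≤ (M + 4) * r) :
    B * (∑ κ ∈ S.colors with B * r ≤ S.reg κ, (#(S.feet κ) - 1)) ^ 2 ≤ 2 * (M + 4) * r ^ 2 := by
  set J := {κ ∈ S.colors | B * r ≤ S.reg κ} with hJ
  have h1 : #J * B ≤ r := by
    have h2 : #J * (B * r) ≤ S.n := by
      rw [← smul_eq_mul, ← sum_const]
      refine (sum_le_sum fun κ hκ => (mem_filter.1 hκ).2).trans (le_trans ?_ S.sum_reg)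
      exact sum_le_sum_of_subset (filter_subset _ _)
    refine Nat.le_of_mul_le_mul_right ?_ hr0
    nlinarith
  have h2 := sq_sum_le_card_mul_sum_sq (s := J) (f := fun κ => #(S.feet κ) - 1)
  have h3 : ∑ κ ∈ J, (#(S.feet κ) - 1) ^ 2 ≤ 2 * #S.ears := by
    rw [ears, card_biUnion (pairwiseDisjoint_earsOf _), mul_sum]
    exact (sum_le_sum fun κ _ => sq_card_feet_sub_one_le κ).trans
      (sum_le_sum_of_subset (filter_subset _ _))
  calc B * (∑ κ ∈ J, (#(S.feet κ) - 1)) ^ 2 ≤ B * (#J * (2 * ((M + 4) * r))) :=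
        Nat.mul_le_mul_left _ (h2.trans (Nat.mul_le_mul_left _ (h3.trans (by omega))))
    _ = (#J * B) * (2 * ((M + 4) * r)) := by ring
    _ ≤ r * (2 * ((M + 4) * r)) := Nat.mul_le_mul_right _ h1
    _ = _ := by ring

lemma exists_ears_card :
    ∃ I ⊆ S.ears, #I = ∑ κ ∈ S.colors, (#(S.feet κ) - 1) ∧
      ∀ κ ∈ S.colors, #{e ∈ I | e.1 = κ} = #(S.feet κ) - 1 := by
  choose A hA hcard using fun κ => exists_subset_card_eq (card_feet_sub_one_le (S := S) κ)
  have hdisj : (S.colors : Set K).PairwiseDisjoint A := fun a ha b hb hab =>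
    disjoint_of_subset_left (hA a) (disjoint_of_subset_right (hA b)
      (pairwiseDisjoint_earsOf S.colors ha hb hab))
  refine ⟨S.colors.biUnion A, fun e he => ?_, ?_, fun κ hκ => ?_⟩
  · obtain ⟨κ, hκ, he⟩ := mem_biUnion.1 he
    exact mem_biUnion.2 ⟨κ, hκ, hA κ he⟩
  · rw [card_biUnion hdisj]
    exact sum_congr rfl fun κ _ => hcard κ
  · rw [← hcard κ]
    congr 1
    ext e
    simp only [mem_filter, mem_biUnion]
    constructor
    · rintro ⟨⟨κ', _, he⟩, rfl⟩
      rwa [(mem_earsOf.1 (hA _ he)).1]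
    · exact fun he => ⟨⟨κ, hκ, he⟩, (mem_earsOf.1 (hA _ he)).1⟩

/-- A system of ears has few feet. -/
lemma sum_feet_sub_one_le {r : ℕ} (hr : S.n + 1 ≤ r ^ 2) (hr0 : 10 ^ 40 ≤ r) :
    10 ^ 5 * ∑ κ ∈ S.colors, (#(S.feet κ) - 1) ≤ (10 ^ 5 + 1) * r := by
  have hpos : 0 < r := by omega
  by_cases hM : ∃ κ ∈ S.colors, 10 ^ 5 * r ≤ #(S.earsOf κ)
  · obtain ⟨κ, hκ, hM⟩ := hM
    exact (sum_feet_le_of_large hr hpos hκ hM).trans (by omega)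
  push Not at hM
  have hW := card_ears_le hr hpos fun κ hκ => (hM κ hκ).le
  obtain ⟨I₀, hI₀, hcard, hcol⟩ := exists_ears_card (S := S)
  rw [← hcard]
  set y := ∑ κ ∈ S.colors with 10 ^ 20 * r ≤ S.reg κ, (#(S.feet κ) - 1) with hy
  have hy1 : 10 ^ 20 * y ^ 2 ≤ 2 * (10 ^ 5 + 4) * r ^ 2 := sum_feet_large_reg_le hr hpos hW
  have hy2 : 10 ^ 7 * y ≤ r := by
    by_contra! h
    nlinarith
  set I := {e ∈ I₀ | S.reg e.1 < 10 ^ 20 * r} with hI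
  have hIe : I ⊆ S.ears := (filter_subset _ _).trans hI₀
  have hI1 : #I₀ ≤ #I + y := by
    rw [← card_filter_add_card_filter_not (fun e => S.reg e.1 < 10 ^ 20 * r)]
    refine Nat.add_le_add_left ?_ _
    have : {e ∈ I₀ | ¬ S.reg e.1 < 10 ^ 20 * r} ⊆
        {κ ∈ S.colors | 10 ^ 20 * r ≤ S.reg κ}.biUnion fun κ => {e ∈ I₀ | e.1 = κ} := by
      intro e he
      simp only [mem_filter, mem_biUnion, not_lt] at he ⊢
      exact ⟨e.1, ⟨(mem_ears.1 (hI₀ he.1)).1, he.2⟩, he.1, rfl⟩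
    refine (card_le_card this).trans (card_biUnion_le.trans ?_)
    exact sum_le_sum fun κ hκ => (hcol κ (mem_filter.1 hκ).1).le
  have hlen : ∀ e ∈ I, S.len e ≤ 10 ^ 20 * r := by
    intro e he
    have h1 := S.len_le (mem_ears.1 (hIe he))
    have h2 := (mem_filter.1 he).2
    omega
  have hcolI : ∀ κ ∈ S.colors, #{e ∈ I | e.1 = κ} ≤ #(S.feet κ) - 1 := fun κ hκ =>
    (card_le_card (filter_subset_filter _ (filter_subset _ _))).trans (hcol κ hκ).le
  by_cases hsmall : #I ≤ r
  · omega
  push Not at hsmall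
  obtain ⟨g, hg, hgT⟩ := exists_few_triplePairs (S := S) (card_pos.1 (hpos.trans hsmall))
  have hT : #(S.triplePairs I g) ≤ 27 * r := by
    refine Nat.le_of_mul_le_mul_left ?_ hpos
    nlinarith [Nat.mul_le_mul_right #(S.triplePairs I g) hsmall.le]
  have hsame : #{x ∈ I ×ˢ I | x.1.1 = x.2.1} ≤ 2 * ((10 ^ 5 + 4) * r) :=
    (card_sameColor_le hIe hcolI).trans (by omega)
  have hp : 10 ^ 7 * #{e ∈ I | e.2 = g.2} ≤ r := by
    have h1 := card_parallel_le (S := S) (P := {e ∈ I | e.2 = g.2})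
      ((filter_subset _ _).trans hIe) (fun e he => hlen e (mem_filter.1 he).1)
      (z := g.2) fun e he => (mem_filter.1 he).2
    set p := #{e ∈ I | e.2 = g.2}
    by_contra! h
    have h2 : 10 ^ 32 ≤ p - 1 := by omega
    have h3 : p * 10 ^ 32 ≤ p * (p - 1) := Nat.mul_le_mul_left _ h2
    omega
  have hd : 10 ^ 7 * #{e ∈ I | e.1 = g.1} ≤ r := by
    have hgc := (mem_ears.1 (hIe hg)).1
    have h1 := (Nat.pow_le_pow_left (hcolI g.1 hgc) 2).trans (sq_card_feet_sub_one_le _)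
    have h2 := hM _ hgc
    set d := #{e ∈ I | e.1 = g.1}
    by_contra! h
    have h3 : d * 10 ^ 32 ≤ d ^ 2 := by
      rw [sq]
      exact Nat.mul_le_mul_left _ (by omega)
    omega
  have hmain := sq_card_mul_le hIe hlen (hIe hg) (10 ^ 30 * r)
  have hsplit := card_le_filter_add I g
  set s := #{e ∈ I | e.2 ≠ g.2 ∧ e.1 ≠ g.1}
  have hs : s ≤ (10 ^ 5 + 4) * r := (card_le_card ((filter_subset _ _).trans hIe)).trans hW
  have hs2 : 10 ^ 7 * s ≤ (10 ^ 7 + 1) * r := by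
    have hl := S.le
    have h1 : 10 ^ 10 * (S.ℓ + 10 ^ 30 * r) ≤ (10 ^ 10 + 1) * r ^ 2 := by nlinarith
    set C : ℕ := (10 ^ 5 + 4) * 10 ^ 30 + (10 ^ 30 + 2 * 10 ^ 20 + 1) ^ 2 +
      (2 * (10 ^ 5 + 4) + 27) * 10 ^ 30 with hC
    have h2 : s * (10 ^ 30 * r) + (10 ^ 30 * r + 2 * (10 ^ 20 * r) + 1) ^ 2 +
        (#{x ∈ I ×ˢ I | x.1.1 = x.2.1} + #(S.triplePairs I g)) * (10 ^ 30 * r) ≤ C * r ^ 2 := by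
      calc _ ≤ (10 ^ 5 + 4) * r * (10 ^ 30 * r) + (10 ^ 30 * r + 2 * (10 ^ 20 * r) + r) ^ 2 +
            (2 * ((10 ^ 5 + 4) * r) + 27 * r) * (10 ^ 30 * r) := by
            gcongr
            exact hpos
        _ = C * r ^ 2 := by rw [hC]; ring
    have h3 : r ^ 2 * (10 ^ 70 * s ^ 2) ≤ r ^ 2 * ((10 ^ 10 + 1) * C * r ^ 2) := by
      calc r ^ 2 * (10 ^ 70 * s ^ 2) = 10 ^ 10 * (s * (10 ^ 30 * r)) ^ 2 := by ring
        _ ≤ 10 ^ 10 * ((S.ℓ + 10 ^ 30 * r) * (C * r ^ 2)) :=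
          Nat.mul_le_mul_left _ (hmain.trans (Nat.mul_le_mul_left _ h2))
        _ = 10 ^ 10 * (S.ℓ + 10 ^ 30 * r) * (C * r ^ 2) := by ring
        _ ≤ (10 ^ 10 + 1) * r ^ 2 * (C * r ^ 2) := Nat.mul_le_mul_right _ h1
        _ = _ := by ring
    have h4 := Nat.le_of_mul_le_mul_left h3 (by positivity)
    by_contra! h5
    have h6 := Nat.mul_self_le_mul_self h5.le
    have h7 : (10 ^ 10 + 1) * C * 10 ^ 14 < 10 ^ 70 * (10 ^ 7 + 1) ^ 2 := by
      rw [hC]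
      norm_num
    have h8 : 0 < r ^ 2 := by positivity
    nlinarith [Nat.mul_lt_mul_of_pos_right h7 h8]
  omega

end EarSystem

end EarBound

section EarPaths

open Finset SimpleGraph

variable {V : Type*} {G : SimpleGraph V} {K : Type*} [DecidableEq K]

lemma SimpleGraph.Walk.IsPath.append_of_inter {u v w : V} {p : G.Walk u v} {q : G.Walk v w}
    (hp : p.IsPath) (hq : q.IsPath) (h : ∀ x ∈ p.support, x ∈ q.support → x = v) :
    (p.append q).IsPath := by
  rw [Walk.isPath_def, Walk.support_append, List.nodup_append']
  have hq' := hq.support_nodup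
  refine ⟨hp.support_nodup, hq'.tail, fun x hx hx' => ?_⟩
  rw [h x hx (List.mem_of_mem_tail hx'), ← q.cons_tail_support] at *
  exact (List.nodup_cons.1 hq').1 hx'

/-- The positions on one of the two arcs between `a` and `b` of a cycle of length `ℓ`; if `w` is
true it is the arc through the wrap-around edge. -/
def arc (ℓ a b : ℕ) (w : Bool) : Set ℕ :=
  {x | x < ℓ ∧ if w then x ≤ min a b ∨ max a b ≤ x else min a b ≤ x ∧ x ≤ max a b}

/-- The length of an arc. -/
def arcLen (ℓ a b : ℕ) (w : Bool) : ℕ :=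
  if w then ℓ - (max a b - min a b) else max a b - min a b

/-- A cycle in a graph, given by its sequence of vertices `γ`, together with families of
ears, that is, paths with both ends on the cycle which run through a region off the cycle. The set
`inc κ x` contains edges from which the use of the foot `x` by an ear of colour `κ` is seen. -/
structure EarFamily (G : SimpleGraph V) (K : Type*) [DecidableEq K] where
  ℓ : ℕ
  γ : ℕ → V
  colors : Finset K
  feet : K → Finset ℕ
  region : K → Set V
  inc : K → ℕ → Set (Sym2 V)
  len : K × ℕ × ℕ → ℕ
  inj : ∀ {i j}, i < ℓ → j < ℓ → γ i = γ j → i = j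
  adj : ∀ {i}, i + 1 < ℓ → G.Adj (γ i) (γ (i + 1))
  adj_wrap : G.Adj (γ (ℓ - 1)) (γ 0)
  two_lt : 2 < ℓ
  feet_lt : ∀ κ ∈ colors, ∀ x ∈ feet κ, x < ℓ
  region_disjoint : ∀ κ ∈ colors, ∀ κ' ∈ colors, κ ≠ κ' → ∀ v ∈ region κ, v ∉ region κ'
  region_off : ∀ κ ∈ colors, ∀ v ∈ region κ, ∀ i < ℓ, v ≠ γ i
  inc_adj : ∀ {i}, i + 1 < ℓ → ∀ κ x, s(γ i, γ (i + 1)) ∉ inc κ x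
  inc_wrap : ∀ κ x, s(γ (ℓ - 1), γ 0) ∉ inc κ x
  exists_path : ∀ e, IsEar colors feet e → ∃ P : G.Walk (γ e.2.1) (γ e.2.2), P.IsPath ∧
    P.length = len e ∧ (∀ v ∈ P.support, v = γ e.2.1 ∨ v = γ e.2.2 ∨ v ∈ region e.1) ∧
    (∀ κ x, (∃ d ∈ P.edges, d ∈ inc κ x) ↔ κ = e.1 ∧ (x = e.2.1 ∨ x = e.2.2)) ∧
    s(γ (ℓ - 1), γ 0) ∉ P.edges

namespace EarFamily

variable (F : EarFamily G K)

lemma exists_path' {e : K × ℕ × ℕ} (he : IsEar F.colors F.feet e) {a b : ℕ} (hab : IsEnds e a b) :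
    ∃ P : G.Walk (F.γ a) (F.γ b), P.IsPath ∧
    P.length = F.len e ∧ (∀ v ∈ P.support, v = F.γ a ∨ v = F.γ b ∨ v ∈ F.region e.1) ∧
    (∀ κ x, (∃ d ∈ P.edges, d ∈ F.inc κ x) ↔ κ = e.1 ∧ (x = e.2.1 ∨ x = e.2.2)) ∧
    s(F.γ (F.ℓ - 1), F.γ 0) ∉ P.edges := by
  obtain ⟨P, h1, h2, h3, h4, h5⟩ := F.exists_path e he
  rcases hab with ⟨rfl, rfl⟩ | ⟨rfl, rfl⟩
  · exact ⟨P, h1, h2, h3, h4, h5⟩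
  · refine ⟨P.reverse, h1.reverse, by simpa, ?_, by simpa using h4, by simpa using h5⟩
    intro v hv
    have := h3 v (by simpa using hv)
    tauto

lemma wrap_ne {i : ℕ} (hi : i + 1 < F.ℓ) : s(F.γ i, F.γ (i + 1)) ≠ s(F.γ (F.ℓ - 1), F.γ 0) := by
  have h2 := F.two_lt
  rw [Ne, Sym2.eq_iff]
  rintro (⟨h, h'⟩ | ⟨h, h'⟩)
  · have := F.inj (by omega) (by omega) h
    omega
  · have := F.inj (by omega) (by omega) h
    have := F.inj (by omega) (by omega) h'
    omega

lemma exists_arc_of_le {a b : ℕ} (hab : a ≤ b) (hb : b < F.ℓ) :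
    ∃ W : G.Walk (F.γ a) (F.γ b), W.IsPath ∧ W.length = b - a ∧
      (∀ v ∈ W.support, ∃ x, a ≤ x ∧ x ≤ b ∧ v = F.γ x) ∧
      (∀ κ x, ∀ d ∈ W.edges, d ∉ F.inc κ x) ∧ s(F.γ (F.ℓ - 1), F.γ 0) ∉ W.edges := by
  induction b, hab using Nat.le_induction with
  | base => exact ⟨.nil, by simp, by simp, by simpa using ⟨a, by simp⟩, by simp, by simp⟩
  | succ b hab ih =>
    obtain ⟨W, h1, h2, h3, h4, h5⟩ := ih (by omega)
    refine ⟨W.concat (F.adj hb), h1.concat (fun h => ?_) _, ?_, ?_, ?_, ?_⟩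
    · obtain ⟨x, -, hx, h⟩ := h3 _ h
      have := F.inj hb (by omega) h
      omega
    · rw [Walk.length_concat]
      omega
    · intro v hv
      rw [Walk.support_concat, List.mem_append, List.mem_singleton] at hv
      rcases hv with hv | rfl
      · obtain ⟨x, hx, hx', h⟩ := h3 _ hv
        exact ⟨x, hx, by omega, h⟩
      · exact ⟨b + 1, by omega, le_rfl, rfl⟩
    · intro κ x d hd
      rw [Walk.edges_concat, List.concat_eq_append, List.mem_append,
        List.mem_singleton] at hd
      rcases hd with hd | rfl
      · exact h4 κ x d hd
      · exact F.inc_adj hb κ x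
    · rw [Walk.edges_concat, List.concat_eq_append, List.mem_append,
        List.mem_singleton]
      rintro (hd | hd)
      · exact h5 hd
      · exact F.wrap_ne hb hd.symm

/-- There is a path from position `a` to position `b` which visits only positions in `A`, uses
exactly the ears in `S`, uses the wrap-around edge if and only if `w` is true, and has length
`k`. -/
def AltPath (a b : ℕ) (A : Set ℕ) (S : Finset (K × ℕ × ℕ)) (w : Bool) (k : ℕ) : Prop :=
  (∀ x ∈ A, x < F.ℓ) ∧ (∀ e ∈ S, IsEar F.colors F.feet e) ∧
  (∀ e ∈ S, ∀ f ∈ S, e.1 = f.1 → e = f) ∧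
  ∃ W : G.Walk (F.γ a) (F.γ b), W.IsPath ∧ W.length = k ∧
    (∀ v ∈ W.support, (∃ x ∈ A, v = F.γ x) ∨ ∃ e ∈ S, v ∈ F.region e.1) ∧
    (∀ κ x, (∃ d ∈ W.edges, d ∈ F.inc κ x) ↔ ∃ e ∈ S, κ = e.1 ∧ (x = e.2.1 ∨ x = e.2.2)) ∧
    (s(F.γ (F.ℓ - 1), F.γ 0) ∈ W.edges ↔ w = true)

/-- There is a cycle of length `k` which uses exactly the ears in `S`, and which uses the
wrap-around edge if and only if `w` is true. -/
def Cyc (S : Finset (K × ℕ × ℕ)) (w : Bool) (k : ℕ) : Prop :=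
  (∀ e ∈ S, IsEar F.colors F.feet e) ∧ (∀ e ∈ S, ∀ f ∈ S, e.1 = f.1 → e = f) ∧
  ∃ (v : V) (c : G.Walk v v), c.IsCycle ∧ c.length = k ∧
    (∀ κ x, (∃ d ∈ c.edges, d ∈ F.inc κ x) ↔ ∃ e ∈ S, κ = e.1 ∧ (x = e.2.1 ∨ x = e.2.2)) ∧
    (s(F.γ (F.ℓ - 1), F.γ 0) ∈ c.edges ↔ w = true)

variable {F}

lemma AltPath.symm {a b : ℕ} {A : Set ℕ} {S : Finset (K × ℕ × ℕ)} {w : Bool} {k : ℕ}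
    (h : F.AltPath a b A S w k) : F.AltPath b a A S w k := by
  obtain ⟨h1, h2, h3, W, h4, h5, h6, h7, h8⟩ := h
  exact ⟨h1, h2, h3, W.reverse, h4.reverse, by simpa, by simpa using h6, by simpa using h7,
    by simpa using h8⟩

lemma altPath_arc_of_le {a b : ℕ} (hab : a ≤ b) (hb : b < F.ℓ) {w : Bool}
    (hw : w = true → a ≠ b) : F.AltPath a b (arc F.ℓ a b w) ∅ w (arcLen F.ℓ a b w) := by
  refine ⟨fun x hx => hx.1, by simp, by simp, ?_⟩
  cases w
  · obtain ⟨W, h1, h2, h3, h4, h5⟩ := F.exists_arc_of_le hab hb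
    refine ⟨W, h1, ?_, fun v hv => Or.inl ?_, ?_, by simpa using h5⟩
    · simp [arcLen, h2, hab]
    · obtain ⟨x, hx, hx', rfl⟩ := h3 v hv
      exact ⟨x, ⟨by omega, by simp [hab, hx, hx']⟩, rfl⟩
    · simpa using h4
  · have hne := hw rfl
    obtain ⟨W, h1, h2, h3, h4, h5⟩ := F.exists_arc_of_le (Nat.zero_le a) (by omega)
    obtain ⟨W', h1', h2', h3', h4', h5'⟩ := F.exists_arc_of_le (Nat.le_sub_one_of_lt hb) (by omega)
    have hp : (Walk.cons F.adj_wrap.symm W'.reverse).IsPath := by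
      rw [Walk.cons_isPath_iff]
      refine ⟨h1'.reverse, fun h => ?_⟩
      obtain ⟨x, hx, hx', h⟩ := h3' _ (by simpa using h)
      have := F.inj (by omega) (by omega) h
      omega
    refine ⟨W.reverse.append (Walk.cons F.adj_wrap.symm W'.reverse),
      h1.reverse.append_of_inter hp ?_, ?_, ?_, ?_, ?_⟩
    · intro v hv hv'
      rw [Walk.support_cons, List.mem_cons] at hv'
      rcases hv' with rfl | hv'
      · rfl
      obtain ⟨x, hx, hx', rfl⟩ := h3 v (by simpa using hv)
      obtain ⟨y, hy, hy', h⟩ := h3' _ (by simpa using hv')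
      have := F.inj (by omega) (by omega) h
      omega
    · simp only [Walk.length_append, Walk.length_reverse, Walk.length_cons, h2, h2', arcLen,
        if_true]
      omega
    · intro v hv
      left
      rw [Walk.mem_support_append_iff, Walk.support_cons, List.mem_cons] at hv
      rcases hv with hv | rfl | hv
      · obtain ⟨x, hx, hx', rfl⟩ := h3 v (by simpa using hv)
        exact ⟨x, ⟨by omega, by simp; omega⟩, rfl⟩
      · exact ⟨0, ⟨by omega, by simp⟩, rfl⟩
      · obtain ⟨x, hx, hx', rfl⟩ := h3' v (by simpa using hv)
        exact ⟨x, ⟨by omega, by simp; omega⟩, rfl⟩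
    · intro κ x
      simp only [Walk.edges_append, Walk.edges_reverse, Walk.edges_cons, List.mem_append,
        List.mem_reverse, List.mem_cons, notMem_empty, false_and, exists_false, iff_false]
      rintro ⟨d, hd | rfl | hd, hd'⟩
      · exact h4 κ x d hd hd'
      · rw [Sym2.eq_swap] at hd'
        exact F.inc_wrap κ x hd'
      · exact h4' κ x d hd hd'
    · simp [Sym2.eq_swap]

lemma altPath_arc {a b : ℕ} (ha : a < F.ℓ) (hb : b < F.ℓ) {w : Bool}
    (hw : w = true → a ≠ b) : F.AltPath a b (arc F.ℓ a b w) ∅ w (arcLen F.ℓ a b w) := by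
  rcases le_total a b with h | h
  · exact altPath_arc_of_le h hb hw
  · have := (altPath_arc_of_le h ha fun h => (hw h).symm).symm
    rwa [arc, arcLen, min_comm, max_comm] at this

end EarFamily

end EarPaths

section EarCycles

open Finset SimpleGraph

variable {V : Type*} {G : SimpleGraph V} {K : Type*} [DecidableEq K]

lemma SimpleGraph.Walk.edges_eq_of_length_eq_one {u v : V} {p : G.Walk u v} (h : p.length = 1) :
    p.edges = [s(u, v)] := by
  cases p with
  | nil => simp at h
  | cons _ q =>
    cases q with
    | nil => simp
    | cons _ _ => simp at h

namespace EarFamily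

variable {F : EarFamily G K} {a b c : ℕ} {A A' : Set ℕ} {S S' : Finset (K × ℕ × ℕ)} {w w' : Bool}
  {k k' : ℕ}

lemma altPath_ear {e : K × ℕ × ℕ} (he : IsEar F.colors F.feet e) (hab : IsEnds e a b) :
    F.AltPath a b {a, b} {e} false (F.len e) := by
  obtain ⟨P, h1, h2, h3, h4, h5⟩ := F.exists_path' he hab
  refine ⟨?_, by simpa, by simp, P, h1, h2, fun v hv => ?_, by simpa using h4, by simpa using h5⟩
  · have h6 := F.feet_lt _ he.1 _ he.2.1
    have h7 := F.feet_lt _ he.1 _ he.2.2.1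
    rcases hab with ⟨rfl, rfl⟩ | ⟨rfl, rfl⟩ <;> simp [h6, h7]
  · have := h3 v hv
    simp only [Set.mem_insert_iff, Set.mem_singleton_iff, exists_eq_or_imp, exists_eq_left,
      mem_singleton]
    tauto

lemma exists_mem_inter (hA : ∀ x ∈ A, x < F.ℓ) (hA' : ∀ x ∈ A', x < F.ℓ)
    (hS : ∀ e ∈ S, IsEar F.colors F.feet e) (hS' : ∀ e ∈ S', IsEar F.colors F.feet e)
    (hne : ∀ e ∈ S, ∀ f ∈ S', e.1 ≠ f.1) {v : V}
    (h : (∃ x ∈ A, v = F.γ x) ∨ ∃ e ∈ S, v ∈ F.region e.1)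
    (h' : (∃ x ∈ A', v = F.γ x) ∨ ∃ e ∈ S', v ∈ F.region e.1) :
    ∃ x ∈ A, x ∈ A' ∧ v = F.γ x := by
  rcases h with ⟨x, hx, rfl⟩ | ⟨e, he, hv⟩ <;> rcases h' with ⟨y, hy, h⟩ | ⟨f, hf, hv'⟩
  · have := F.inj (hA x hx) (hA' y hy) h
    subst this
    exact ⟨x, hx, hy, rfl⟩
  · exact absurd rfl (F.region_off _ (hS' f hf).1 _ hv' x (hA x hx))
  · exact absurd h (F.region_off _ (hS e he).1 _ hv y (hA' y hy))
  · exact absurd hv' (F.region_disjoint _ (hS e he).1 _ (hS' f hf).1 (hne e he f hf) _ hv)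

lemma eq_of_fst_eq_union (h : ∀ e ∈ S, ∀ f ∈ S, e.1 = f.1 → e = f)
    (h' : ∀ e ∈ S', ∀ f ∈ S', e.1 = f.1 → e = f) (hne : ∀ e ∈ S, ∀ f ∈ S', e.1 ≠ f.1) :
    ∀ e ∈ S ∪ S', ∀ f ∈ S ∪ S', e.1 = f.1 → e = f := by
  intro e he f hf hef
  rcases mem_union.1 he with he | he <;> rcases mem_union.1 hf with hf | hf
  · exact h e he f hf hef
  · exact absurd hef (hne e he f hf)
  · exact absurd hef.symm (hne f hf e he)
  · exact h' e he f hf hef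

lemma AltPath.append (h : F.AltPath a b A S w k) (h' : F.AltPath b c A' S' w' k')
    (hA : ∀ x ∈ A, x ∈ A' → x = b) (hne : ∀ e ∈ S, ∀ f ∈ S', e.1 ≠ f.1) :
    F.AltPath a c (A ∪ A') (S ∪ S') (w || w') (k + k') := by
  obtain ⟨h1, h2, h3, W, h4, h5, h6, h7, h8⟩ := h
  obtain ⟨h1', h2', h3', W', h4', h5', h6', h7', h8'⟩ := h'
  refine ⟨fun x hx => hx.elim (h1 x) (h1' x), fun e he => (mem_union.1 he).elim (h2 e) (h2' e),
    eq_of_fst_eq_union h3 h3' hne, W.append W', h4.append_of_inter h4' fun v hv hv' => ?_,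
    by rw [Walk.length_append, h5, h5'], fun v hv => ?_, fun κ x => ?_, ?_⟩
  · obtain ⟨x, hx, hx', rfl⟩ := exists_mem_inter h1 h1' h2 h2' hne (h6 v hv) (h6' v hv')
    rw [hA x hx hx']
  · rw [Walk.mem_support_append_iff] at hv
    simp only [Set.mem_union, mem_union, or_and_right, exists_or]
    rcases hv with hv | hv
    · exact (h6 v hv).elim (fun h => Or.inl (Or.inl h)) fun h => Or.inr (Or.inl h)
    · exact (h6' v hv).elim (fun h => Or.inl (Or.inr h)) fun h => Or.inr (Or.inr h)
  · simp only [Walk.edges_append, List.mem_append, mem_union, or_and_right, exists_or, h7, h7']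
  · simp only [Walk.edges_append, List.mem_append, h8, h8', Bool.or_eq_true]

lemma AltPath.close (h : F.AltPath a b A S w k) (h' : F.AltPath b a A' S' w' k')
    (hA : ∀ x ∈ A, x ∈ A' → x = a ∨ x = b) (hne : ∀ e ∈ S, ∀ f ∈ S', e.1 ≠ f.1) (hab : a ≠ b)
    (ha : a < F.ℓ) (hb : b < F.ℓ) (hS : S'.Nonempty) : F.Cyc (S ∪ S') (w || w') (k + k') := by
  obtain ⟨h1, h2, h3, W, h4, h5, h6, h7, h8⟩ := h
  obtain ⟨h1', h2', h3', W', h4', h5', h6', h7', h8'⟩ := h'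
  have hne' : F.γ a ≠ F.γ b := fun h => hab (F.inj ha hb h)
  refine ⟨fun e he => (mem_union.1 he).elim (h2 e) (h2' e),
    eq_of_fst_eq_union h3 h3' hne, _, W.append W', h4.isCycle_append h4' ?_ ?_,
    by rw [Walk.length_append, h5, h5'], fun κ x => ?_, ?_⟩
  · intro v hv hv'
    obtain ⟨x, hx, hx', rfl⟩ := exists_mem_inter h1 h1' h2 h2' hne
      (h6 v (List.mem_of_mem_tail hv)) (h6' v (List.mem_of_mem_tail hv'))
    have h9 := h4.support_nodup
    have h10 := h4'.support_nodup
    rw [← W.cons_tail_support] at h9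
    rw [← W'.cons_tail_support] at h10
    rcases hA x hx hx' with rfl | rfl
    · exact (List.nodup_cons.1 h9).1 hv
    · exact (List.nodup_cons.1 h10).1 hv'
  · by_contra! hlen
    have h9 : W.length ≠ 0 := fun h => hne' (Walk.eq_of_length_eq_zero h)
    have h10 : W'.length ≠ 0 := fun h => hne' (Walk.eq_of_length_eq_zero h).symm
    have h11 := Walk.edges_eq_of_length_eq_one (show W.length = 1 by omega)
    have h12 := Walk.edges_eq_of_length_eq_one (show W'.length = 1 by omega)
    obtain ⟨e, he⟩ := hS
    obtain ⟨d, hd, hd'⟩ := (h7' e.1 e.2.1).2 ⟨e, he, rfl, Or.inl rfl⟩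
    rw [h12, Sym2.eq_swap, ← h11] at hd
    obtain ⟨f, hf, hfe, -⟩ := (h7 e.1 e.2.1).1 ⟨d, hd, hd'⟩
    exact hne f hf e he hfe.symm
  · simp only [Walk.edges_append, List.mem_append, mem_union, or_and_right, exists_or, h7, h7']
  · simp only [Walk.edges_append, List.mem_append, h8, h8', Bool.or_eq_true]

lemma Cyc.eq_of_length_eq (hG : ∀ (u v : V) (c₁ : G.Walk u u) (c₂ : G.Walk v v),
    c₁.IsCycle → c₂.IsCycle → c₁.length = c₂.length →
      {e | e ∈ c₁.edges} = {e | e ∈ c₂.edges}) (h : F.Cyc S w k) (h' : F.Cyc S' w' k) :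
    S = S' ∧ w = w' := by
  obtain ⟨h1, h2, v, c, h3, h4, h5, h6⟩ := h
  obtain ⟨h1', h2', v', c', h3', h4', h5', h6'⟩ := h'
  have hE : ∀ d, d ∈ c.edges ↔ d ∈ c'.edges := fun d =>
    Set.ext_iff.1 (hG v v' c c' h3 h3' (h4.trans h4'.symm)) d
  simp only [hE, h5'] at h5
  simp only [hE, h6'] at h6
  have key : ∀ T T' : Finset (K × ℕ × ℕ), (∀ e ∈ T, IsEar F.colors F.feet e) →
      (∀ e ∈ T', IsEar F.colors F.feet e) → (∀ e ∈ T', ∀ f ∈ T', e.1 = f.1 → e = f) →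
      (∀ κ x, (∃ e ∈ T', κ = e.1 ∧ (x = e.2.1 ∨ x = e.2.2)) ↔
        ∃ e ∈ T, κ = e.1 ∧ (x = e.2.1 ∨ x = e.2.2)) → T ⊆ T' := by
    intro T T' hT hT' huniq hsig e he
    obtain ⟨f, hf, hfe, hx⟩ := (hsig e.1 e.2.1).2 ⟨e, he, rfl, Or.inl rfl⟩
    obtain ⟨f', hf', hfe', hx'⟩ := (hsig e.1 e.2.2).2 ⟨e, he, rfl, Or.inr rfl⟩
    have := huniq f hf f' hf' (hfe.symm.trans hfe')
    subst this
    have h7 := (hT e he).2.2.2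
    have h8 := (hT' f hf).2.2.2
    have h9 : e = f := Prod.ext hfe (Prod.ext (by omega) (by omega))
    rwa [h9]
  refine ⟨Subset.antisymm (key S S' h1 h1' h2' h5)
    (key S' S h1' h1 h2 fun κ x => (h5 κ x).symm), ?_⟩
  rw [Bool.eq_iff_iff, h6]

lemma Cyc.le_card [Fintype V] (h : F.Cyc S w k) : k ≤ Fintype.card V := by
  obtain ⟨-, -, v, c, h3, rfl, -⟩ := h
  have h4 := h3.support_nodup.length_le_card
  rwa [List.length_tail, Walk.length_support, Nat.add_sub_cancel] at h4

end EarFamily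

end EarCycles

section EarFamilySystem

open Finset SimpleGraph

variable {V : Type*} {G : SimpleGraph V} {K : Type*} [DecidableEq K]

lemma left_mem_arc {ℓ a b : ℕ} (ha : a < ℓ) (w : Bool) : a ∈ arc ℓ a b w := by
  refine ⟨ha, ?_⟩
  split_ifs <;> omega

lemma right_mem_arc {ℓ a b : ℕ} (hb : b < ℓ) (w : Bool) : b ∈ arc ℓ a b w := by
  refine ⟨hb, ?_⟩
  split_ifs <;> omega

lemma mem_arc_false {ℓ a b x : ℕ} : x ∈ arc ℓ a b false ↔ x < ℓ ∧ min a b ≤ x ∧ x ≤ max a b := by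
  simp [arc]

lemma mem_arc_true {ℓ a b x : ℕ} :
    x ∈ arc ℓ a b true ↔ x < ℓ ∧ (x ≤ min a b ∨ max a b ≤ x) := by
  simp [arc]

lemma IsEnds.lt {K : Type*} [DecidableEq K] {colors : Finset K} {feet : K → Finset ℕ}
    {e : K × ℕ × ℕ} {ℓ a b : ℕ} (hab : IsEnds e a b) (he : IsEar colors feet e)
    (h : ∀ κ ∈ colors, ∀ x ∈ feet κ, x < ℓ) : a < ℓ ∧ b < ℓ ∧ a ≠ b := by
  have h6 := h _ he.1 _ he.2.1
  have h7 := h _ he.1 _ he.2.2.1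
  have h8 := he.2.2.2
  rcases hab with ⟨rfl, rfl⟩ | ⟨rfl, rfl⟩ <;> omega

namespace EarFamily

variable {F : EarFamily G K} {a b a' b' a'' b'' c : ℕ} {e f g : K × ℕ × ℕ} {w w' w'' : Bool}

lemma altPath_ear_arc (he : IsEar F.colors F.feet e) (hab : IsEnds e a b) (hc : c < F.ℓ)
    (ha : a ∉ arc F.ℓ b c w) (hbc : w = true → b ≠ c) :
    F.AltPath a c (insert a (arc F.ℓ b c w)) {e} w (F.len e + arcLen F.ℓ b c w) := by
  obtain ⟨-, hb, -⟩ := hab.lt he F.feet_lt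
  have h := (altPath_ear he hab).append (altPath_arc hb hc hbc) (by aesop) (by simp)
  have h1 : ({a, b} ∪ arc F.ℓ b c w : Set ℕ) = insert a (arc F.ℓ b c w) := by
    have := left_mem_arc (b := c) hb w
    ext x
    simp only [Set.mem_union, Set.mem_insert_iff, Set.mem_singleton_iff]
    constructor
    · rintro ((h | rfl) | h)
      exacts [Or.inl h, Or.inr this, Or.inr h]
    · rintro (h | h)
      exacts [Or.inl (Or.inl h), Or.inr h]
  rwa [h1, union_empty, Bool.false_or] at h

lemma cyc_one (he : IsEar F.colors F.feet e) (w : Bool) :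
    F.Cyc {e} w (arcLen F.ℓ e.2.2 e.2.1 w + F.len e) := by
  have hab : IsEnds e e.2.1 e.2.2 := Or.inl ⟨rfl, rfl⟩
  obtain ⟨ha, hb, hne⟩ := hab.lt he F.feet_lt
  have h := (altPath_arc (w := w) hb ha fun _ => hne.symm).close (altPath_ear he hab)
    (by simp; tauto) (by simp) hne.symm hb ha (by simp)
  rwa [empty_union, Bool.or_false] at h

lemma cyc_two (he : IsEar F.colors F.feet e) (hf : IsEar F.colors F.feet f) (hef : e.1 ≠ f.1)
    (hab : IsEnds e a b) (hab' : IsEnds f a' b')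
    (hA : Disjoint (arc F.ℓ b a' w) (arc F.ℓ b' a w'))
    (hw : w = true → b ≠ a') (hw' : w' = true → b' ≠ a) :
    F.Cyc {e, f} (w || w') (F.len e + arcLen F.ℓ b a' w + (F.len f + arcLen F.ℓ b' a w')) := by
  obtain ⟨ha, hb, hne⟩ := hab.lt he F.feet_lt
  obtain ⟨ha', hb', hne'⟩ := hab'.lt hf F.feet_lt
  rw [Set.disjoint_left] at hA
  have i1 := left_mem_arc (b := a') hb w
  have i2 := right_mem_arc (a := b) ha' w
  have i3 := left_mem_arc (b := a) hb' w'
  have i4 := right_mem_arc (a := b') ha w'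
  have h1 := altPath_ear_arc he hab ha' (fun h => hA h i4) hw
  have h2 := altPath_ear_arc hf hab' ha (hA i2) hw'
  refine h1.close h2 ?_ (by simpa) ?_ ha ha' (by simp)
  · rintro x (rfl | hx) (rfl | hx')
    exacts [Or.inl rfl, Or.inl rfl, Or.inr rfl, absurd hx' (hA hx)]
  · rintro rfl
    exact hA i2 i4

lemma cyc_three (he : IsEar F.colors F.feet e) (hf : IsEar F.colors F.feet f)
    (hg : IsEar F.colors F.feet g) (hef : e.1 ≠ f.1) (hfg : f.1 ≠ g.1) (heg : e.1 ≠ g.1)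
    (hab : IsEnds e a b) (hab' : IsEnds f a' b') (hab'' : IsEnds g a'' b'')
    (hA : Disjoint (arc F.ℓ b a' w) (arc F.ℓ b' a'' w'))
    (hA' : Disjoint (arc F.ℓ b' a'' w') (arc F.ℓ b'' a w''))
    (hA'' : Disjoint (arc F.ℓ b a' w) (arc F.ℓ b'' a w''))
    (hw : w = true → b ≠ a') (hw' : w' = true → b' ≠ a'') (hw'' : w'' = true → b'' ≠ a) :
    ∃ w k, F.Cyc {e, f, g} w k := by
  obtain ⟨ha, hb, hne⟩ := hab.lt he F.feet_lt
  obtain ⟨ha', hb', hne'⟩ := hab'.lt hf F.feet_lt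
  obtain ⟨ha'', hb'', hne''⟩ := hab''.lt hg F.feet_lt
  rw [Set.disjoint_left] at hA hA' hA''
  have i1 := left_mem_arc (b := a') hb w
  have i2 := right_mem_arc (a := b) ha' w
  have i3 := left_mem_arc (b := a'') hb' w'
  have i4 := right_mem_arc (a := b') ha'' w'
  have i5 := left_mem_arc (b := a) hb'' w''
  have i6 := right_mem_arc (a := b'') ha w''
  have h1 := altPath_ear_arc he hab ha' (fun h => hA'' h i6) hw
  have h2 := altPath_ear_arc hf hab' ha'' (hA i2) hw'
  have h3 := altPath_ear_arc hg hab'' ha (hA' i4) hw''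
  have h12 := h1.append h2 (by
    rintro x (rfl | hx) (hx' | hx')
    exacts [hx', absurd i6 (hA' hx'), hx', absurd hx' (hA hx)]) (by simpa)
  refine ⟨_, _, (insert_eq e {f, g}) ▸ (insert_eq f {g}) ▸ union_assoc {e} {f} {g} ▸
    h12.close h3 ?_ ?_ ?_ ha ha'' (by simp)⟩
  · rintro x ((rfl | hx) | (rfl | hx)) (rfl | hx')
    exacts [Or.inl rfl, Or.inl rfl, Or.inr rfl, absurd hx' (hA'' hx), Or.inr rfl,
      absurd hx' (hA'' i2), Or.inr rfl, absurd hx' (hA' hx)]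
  · simp [hfg, heg]
  · rintro rfl
    exact hA' i4 i6

/-- The combinatorial data of a family of ears in a graph in which cycles are determined by their
lengths. -/
noncomputable def toEarSystem [Fintype V] (F : EarFamily G K)
    (hG : ∀ (u v : V) (c₁ : G.Walk u u) (c₂ : G.Walk v v), c₁.IsCycle → c₂.IsCycle →
      c₁.length = c₂.length → {e | e ∈ c₁.edges} = {e | e ∈ c₂.edges})
    (hlen : ∀ e, IsEar F.colors F.feet e → F.len e ≤ (F.region e.1).ncard + 1) :
    EarSystem K where
  ℓ := F.ℓ
  n := Fintype.card V
  colors := F.colors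
  feet := F.feet
  reg κ := (F.region κ).ncard
  len := F.len
  cyc := F.Cyc
  le := by
    have h : Function.Injective fun i : Fin F.ℓ => F.γ i :=
      fun i j h => Fin.ext (F.inj i.2 j.2 h)
    simpa using Fintype.card_le_of_injective _ h
  feet_lt := F.feet_lt
  sum_reg := by
    classical
    have h : ∀ κ, (F.region κ).ncard = #(F.region κ).toFinset := fun κ =>
      Set.ncard_eq_toFinset_card' _
    simp only [h]
    rw [← card_biUnion, ← card_univ]
    · exact card_le_card (subset_univ _)
    · intro κ hκ κ' hκ' hne
      refine Finset.disjoint_left.2 fun v hv hv' => ?_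
      exact F.region_disjoint κ hκ κ' hκ' hne v (by simpa using hv) (by simpa using hv')
  len_le := hlen _
  cyc_le := Cyc.le_card
  cyc_inj := Cyc.eq_of_length_eq hG
  one_inner {e} he := by
    have h := cyc_one he false
    have := he.2.2.2
    convert h using 2
    simp [arcLen, this.le]
  one_wrap {e} he := by
    have h := cyc_one he true
    have := he.2.2.2
    convert h using 2
    simp [arcLen, this.le]
  two_nested {e f} he hf hef hs := by
    have h := cyc_two (w := false) (w' := false) he hf hef (Or.inl ⟨rfl, rfl⟩)
      (Or.inr ⟨rfl, rfl⟩) ?_ (by simp) (by simp)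
    · refine ⟨_, (congrArg (F.Cyc {e, f} _) ?_).mp h⟩
      simp only [arcLen, Bool.false_eq_true, if_false]
      omega
    · rw [Set.disjoint_left]
      intro x hx hx'
      rw [mem_arc_false] at hx hx'
      unfold Separated at hs
      omega
  two_disjoint {e f} he hf hef hs := by
    have h1 := he.2.2.2
    have h2 := hf.2.2.2
    have h3 := F.feet_lt _ hf.1 _ hf.2.2.1
    have h := cyc_two (w := false) (w' := true) he hf hef (Or.inl ⟨rfl, rfl⟩)
      (Or.inl ⟨rfl, rfl⟩) ?_ (by simp) (by omega)
    · refine ⟨_, (congrArg (F.Cyc {e, f} _) ?_).mp h⟩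
      simp only [arcLen, Bool.false_eq_true, if_false, if_true]
      omega
    · rw [Set.disjoint_left]
      intro x hx hx'
      rw [mem_arc_false] at hx
      rw [mem_arc_true] at hx'
      omega
  three_inner {e f g} he hf hg hef hfg heg a b a' b' a'' b'' hab hab' hab'' h1 h2 h3 := by
    unfold Separated at h1 h2 h3
    refine cyc_three (w := false) (w' := false) (w'' := false) he hf hg hef hfg heg hab hab' hab''
      ?_ ?_ ?_ (by simp) (by simp) (by simp)
    all_goals
      rw [Set.disjoint_left]
      intro x hx hx'
      rw [mem_arc_false] at hx hx'
      omega
  three_wrap {e f g} he hf hg hef hfg heg a b a' b' a'' b'' hab hab' hab'' h1 h2 h3 := by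
    unfold Separated at h1
    refine cyc_three (w := false) (w' := false) (w'' := true) he hf hg hef hfg heg hab hab' hab''
      ?_ ?_ ?_ (by simp) (by simp) (by omega)
    all_goals
      rw [Set.disjoint_left]
      intro x hx hx'
      simp only [mem_arc_false, mem_arc_true] at hx hx'
      omega

end EarFamily

end EarFamilySystem

section Forests

open Finset SimpleGraph

variable {V : Type*} {G : SimpleGraph V}

lemma SimpleGraph.card_connectedComponent_lt_deleteEdges [Finite V] {u v : V} (h : G.Adj u v)
    (hb : G.IsBridge s(u, v)) :
    Nat.card G.ConnectedComponent < Nat.card (G.deleteEdges {s(u, v)}).ConnectedComponent := by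
  classical
  have hs := ConnectedComponent.surjective_map_ofLE (G.deleteEdges_le {s(u, v)})
  refine lt_of_le_of_ne (Nat.card_le_card_of_surjective _ hs) fun hc => ?_
  have hi := (Function.Surjective.bijective_of_nat_card_le hs hc.ge).1
  rw [isBridge_iff] at hb
  refine hb (ConnectedComponent.exact (hi ?_))
  exact ConnectedComponent.sound h.reachable

lemma SimpleGraph.IsAcyclic.card_edgeSet_add_card_connectedComponent_le [Finite V]
    (hG : G.IsAcyclic) : G.edgeSet.ncard + Nat.card G.ConnectedComponent ≤ Nat.card V := by
  induction hn : G.edgeSet.ncard generalizing G with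
  | zero =>
    rw [zero_add]
    exact Nat.card_le_card_of_surjective G.connectedComponentMk Quot.mk_surjective
  | succ n ih =>
    have h0 : 0 < G.edgeSet.ncard := by omega
    obtain ⟨e, he⟩ := (Set.ncard_pos (Set.toFinite _)).1 h0
    obtain ⟨u, v⟩ := e
    have h1 := card_connectedComponent_lt_deleteEdges (u := u) (v := v) he
      (isAcyclic_iff_forall_isBridge.1 hG he)
    have h2 := ih (G := G.deleteEdges {s(u, v)}) (hG.anti (G.deleteEdges_le {s(u, v)})) (by
      rw [edgeSet_deleteEdges, Set.ncard_sdiff_singleton_of_mem he, hn, Nat.add_sub_cancel])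
    omega

end Forests

section OffPart

open Finset SimpleGraph

variable {V : Type*} {B : SimpleGraph V} {C : Set V}

/-- The graph formed by the edges of `B` with both ends outside `C`. -/
def offPart (B : SimpleGraph V) (C : Set V) : SimpleGraph V where
  Adj x y := B.Adj x y ∧ x ∉ C ∧ y ∉ C
  symm := ⟨fun _ _ h => ⟨h.1.symm, h.2.2, h.2.1⟩⟩
  loopless := ⟨fun _ h => h.1.ne rfl⟩

lemma offPart_le : offPart B C ≤ B := fun _ _ h => h.1

/-- The vertices of `C` adjacent to a given component of the graph outside `C`. -/
def attached (B : SimpleGraph V) (C : Set V) (D : (offPart B C).ConnectedComponent) : Set V :=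
  {x | x ∈ C ∧ ∃ y, y ∉ C ∧ (offPart B C).connectedComponentMk y = D ∧ B.Adj y x}

lemma notMem_of_walk_offPart {x y : V} (p : (offPart B C).Walk x y) (hx : x ∉ C) :
    ∀ v ∈ p.support, v ∉ C := by
  induction p with
  | nil => simpa
  | cons h p ih =>
    simp only [Walk.support_cons, List.mem_cons, forall_eq_or_imp]
    exact ⟨hx, ih h.2.2⟩

lemma eq_of_reachable_offPart {x y : V} (h : (offPart B C).Reachable x y) (hx : x ∈ C) : x = y := by
  obtain ⟨p⟩ := h
  cases p with
  | nil => rfl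
  | cons h p => exact absurd hx h.2.1

/-- Every cycle visits at least two vertices of `C`. -/
def CyclesVisitTwice (B : SimpleGraph V) (C : Set V) : Prop :=
  ∀ (v : V) (p : B.Walk v v), p.IsCycle → ∃ x ∈ p.support, ∃ y ∈ p.support, x ∈ C ∧ y ∈ C ∧ x ≠ y

lemma CyclesVisitTwice.isAcyclic_offPart (h : CyclesVisitTwice B C) : (offPart B C).IsAcyclic := by
  intro v p hp
  obtain ⟨x, hx, -, -, hx', -⟩ := h v _ (hp.mapLe offPart_le)
  rw [Walk.support_mapLe_eq_support] at hx
  cases p with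
  | nil => exact absurd hp (by simp)
  | cons h' p => exact notMem_of_walk_offPart (.cons h' p) h'.2.1 x hx hx'

lemma exists_path_through_component {x' y y' : V} (hx' : x' ∈ C) (hy : y ∉ C)
    (hyx' : B.Adj y' x')
    (hyy : (offPart B C).Reachable y y') : ∃ P : B.Walk y x', P.IsPath ∧
      (∀ v ∈ P.support, v = x' ∨ v ∉ C ∧
        (offPart B C).connectedComponentMk v = (offPart B C).connectedComponentMk y) ∧
      (∀ v ∉ C, ∀ z ∈ C, s(v, z) ∈ P.edges ↔ v = y' ∧ z = x') ∧
      (∀ v ∈ C, ∀ z ∈ C, s(v, z) ∉ P.edges) ∧ ∃ l : List V, l.Nodup ∧ P.length = l.length ∧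
        ∀ v ∈ l, v ∉ C ∧
          (offPart B C).connectedComponentMk v = (offPart B C).connectedComponentMk y := by
  classical
  obtain ⟨Q, hQ⟩ := hyy.exists_isPath
  have h1 := notMem_of_walk_offPart Q hy
  have h2 : ∀ v ∈ Q.support, v ∉ C ∧
      (offPart B C).connectedComponentMk v = (offPart B C).connectedComponentMk y := fun v hv =>
    ⟨h1 v hv, (ConnectedComponent.sound ⟨Q.takeUntil v hv⟩).symm⟩
  have h3 : ∀ v z, s(v, z) ∈ Q.edges → v ∉ C ∧ z ∉ C := fun v z h => (Q.adj_of_mem_edges h).2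
  refine ⟨(Q.mapLe offPart_le).concat hyx', (hQ.mapLe offPart_le).concat ?_ _, ?_, ?_, ?_,
    Q.support, hQ.support_nodup, ?_, h2⟩
  · rw [Walk.support_mapLe_eq_support]
    exact fun h => h1 _ h hx'
  · intro v hv
    rw [Walk.support_concat, Walk.support_mapLe_eq_support, List.mem_append,
      List.mem_singleton] at hv
    exact hv.symm.imp_right (h2 v)
  · intro v hv z hz
    rw [Walk.edges_concat, Walk.edges_mapLe_eq_edges, List.concat_eq_append, List.mem_append,
      List.mem_singleton, Sym2.eq_iff]
    constructor
    · rintro (h | h | ⟨rfl, -⟩)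
      · exact absurd hz (h3 _ _ h).2
      · exact h
      · exact absurd hx' hv
    · exact fun h => Or.inr (Or.inl h)
  · intro v hv z hz
    rw [Walk.edges_concat, Walk.edges_mapLe_eq_edges, List.concat_eq_append, List.mem_append,
      List.mem_singleton, Sym2.eq_iff]
    have := h1 y' Q.end_mem_support
    rintro (h | ⟨rfl, -⟩ | ⟨-, rfl⟩)
    · exact (h3 _ _ h).1 hv
    · exact this hv
    · exact this hz
  · simp [Walk.length_support]

lemma CyclesVisitTwice.eq_of_adj (h : CyclesVisitTwice B C) {x y y' : V} (hx : x ∈ C) (hy : y ∉ C)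
    (hyx : B.Adj y x) (hyx' : B.Adj y' x) (hyy : (offPart B C).Reachable y y') : y = y' := by
  obtain ⟨P, h1, h2, h3, -⟩ := exists_path_through_component hx hy hyx' hyy
  by_contra hne
  obtain ⟨v, hv, w, hw, hv', hw', hvw⟩ := h x (Walk.cons hyx.symm P) (by
    rw [Walk.cons_isCycle_iff]
    refine ⟨h1, fun he => ?_⟩
    rw [Sym2.eq_swap, h3 y hy x hx] at he
    exact hne he.1)
  have key : ∀ v ∈ (Walk.cons hyx.symm P).support, v ∈ C → v = x := by
    intro v hv hv'
    rw [Walk.support_cons, List.mem_cons] at hv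
    rcases hv with hv | hv
    · exact hv
    · exact (h2 v hv).resolve_right fun h => h.1 hv'
  exact hvw ((key v hv hv').trans (key w hw hw').symm)

lemma CyclesVisitTwice.ncard_edgeSet_add_le [Fintype V] [Fintype (offPart B C).ConnectedComponent]
    (h : CyclesVisitTwice B C) (hB : ∀ x y, B.Adj x y → x ∉ C ∨ y ∉ C) :
    B.edgeSet.ncard + C.ncard ≤ Fintype.card V + ∑ D, ((attached B C D).ncard - 1) := by
  classical
  have h1 := h.isAcyclic_offPart.card_edgeSet_add_card_connectedComponent_le
  have h2 : B.edgeSet.ncard ≤ (offPart B C).edgeSet.ncard + ∑ D, (attached B C D).ncard := by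
    have h3 : ∀ p : (offPart B C).ConnectedComponent × V, ∃ y, p.2 ∈ attached B C p.1 →
        y ∉ C ∧ (offPart B C).connectedComponentMk y = p.1 ∧ B.Adj y p.2 := by
      intro p
      by_cases hp : p.2 ∈ attached B C p.1
      · obtain ⟨-, y, hy⟩ := hp
        exact ⟨y, fun _ => hy⟩
      · exact ⟨p.2, fun hp' => absurd hp' hp⟩
    choose g hg using h3
    have h4 : B.edgeSet ⊆ (offPart B C).edgeSet ∪
        ↑(((univ : Finset (offPart B C).ConnectedComponent).biUnion fun D =>
          (attached B C D).toFinset.image fun x => (D, x)).image fun p => s(g p, p.2)) := by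
      have h5 : ∀ x y, B.Adj y x → x ∈ C → s(g ((offPart B C).connectedComponentMk y, x), x) =
          s(y, x) ∧ x ∈ attached B C ((offPart B C).connectedComponentMk y) := by
        intro x y hyx hx
        have hy : y ∉ C := (hB y x hyx).resolve_right fun h => h hx
        have hm : x ∈ attached B C ((offPart B C).connectedComponentMk y) := ⟨hx, y, hy, rfl, hyx⟩
        obtain ⟨h6, h7, h8⟩ := hg ((offPart B C).connectedComponentMk y, x) hm
        rw [h.eq_of_adj hx h6 h8 hyx (ConnectedComponent.exact h7)]
        exact ⟨rfl, hm⟩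
      intro e he
      induction e with | _ x y =>
      by_cases hx : x ∈ C
      · obtain ⟨h6, h7⟩ := h5 x y he.symm hx
        right
        simp only [coe_image, Set.mem_image, mem_coe, mem_biUnion, mem_univ, true_and, mem_image,
          Set.mem_toFinset]
        exact ⟨_, ⟨_, x, h7, rfl⟩, h6.trans Sym2.eq_swap⟩
      by_cases hy : y ∈ C
      · obtain ⟨h6, h7⟩ := h5 y x he hy
        right
        simp only [coe_image, Set.mem_image, mem_coe, mem_biUnion, mem_univ, true_and, mem_image,
          Set.mem_toFinset]
        exact ⟨_, ⟨_, y, h7, rfl⟩, h6⟩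
      · exact Or.inl ⟨he, hx, hy⟩
    refine (Set.ncard_le_ncard h4 (Set.toFinite _)).trans ((Set.ncard_union_le _ _).trans ?_)
    rw [Set.ncard_coe_finset]
    gcongr
    refine card_image_le.trans (card_biUnion_le.trans (sum_le_sum fun D _ => ?_))
    rw [Set.ncard_eq_toFinset_card']
    exact card_image_le
  have h3 : C.ncard + #{D | (attached B C D).Nonempty} ≤
      Nat.card (offPart B C).ConnectedComponent := by
    rw [Nat.card_eq_fintype_card, Set.ncard_eq_toFinset_card', ← card_image_of_injOn
      (f := (offPart B C).connectedComponentMk), ← card_union_of_disjoint]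
    · exact card_le_univ _
    · refine Finset.disjoint_left.2 fun D hD hD' => ?_
      simp only [mem_image, Set.mem_toFinset, mem_filter, mem_univ, true_and] at hD hD'
      obtain ⟨x, hx, rfl⟩ := hD
      obtain ⟨z, hz, y, hy, hyx, -⟩ := hD'
      rw [← eq_of_reachable_offPart (ConnectedComponent.exact hyx.symm) hx] at hy
      exact hy hx
    · intro x hx y hy hxy
      exact eq_of_reachable_offPart (ConnectedComponent.exact hxy) (by simpa using hx)
  have h4 : ∑ D, (attached B C D).ncard ≤
      ∑ D, ((attached B C D).ncard - 1) + #{D | (attached B C D).Nonempty} := by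
    rw [card_filter, ← sum_add_distrib]
    refine sum_le_sum fun D _ => ?_
    split_ifs with hD
    · omega
    · simp [Set.not_nonempty_iff_eq_empty.1 hD]
  rw [Nat.card_eq_fintype_card (α := V)] at h1
  omega

end OffPart

section EarsOfCycle

open Finset SimpleGraph

variable {V : Type*} {G B : SimpleGraph V}

lemma SimpleGraph.Walk.IsCycle.exists_enumeration {u : V} {c : G.Walk u u} (hc : c.IsCycle) :
    ∃ γ : ℕ → V, (∀ i < c.length, ∀ j < c.length, γ i = γ j → i = j) ∧
      (∀ i, i + 1 < c.length → s(γ i, γ (i + 1)) ∈ c.edges) ∧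
      s(γ (c.length - 1), γ 0) ∈ c.edges ∧
      ∀ v, v ∈ c.support ↔ ∃ i < c.length, γ i = v := by
  have h3 := hc.three_le_length
  have he : ∀ i < c.length, s(c.getVert i, c.getVert (i + 1)) ∈ c.edges := fun i hi =>
    Walk.adj_toSubgraph_iff_mem_edges.1 (c.toSubgraph_adj_getVert hi)
  refine ⟨c.getVert, fun i hi j hj h => ?_, fun i hi => he i (by omega), ?_, fun v => ?_⟩
  · exact hc.getVert_injOn' (by simp; omega) (by simp; omega) h
  · rw [Walk.getVert_zero]
    have := he (c.length - 1) (by omega)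
    rwa [Nat.sub_add_cancel (by omega), Walk.getVert_length] at this
  · rw [Walk.mem_support_iff_exists_getVert]
    constructor
    · rintro ⟨n, rfl, hn⟩
      rcases hn.lt_or_eq with hn | rfl
      · exact ⟨n, hn, rfl⟩
      · exact ⟨0, by omega, by simp⟩
    · rintro ⟨i, hi, rfl⟩
      exact ⟨i, rfl, hi.le⟩

lemma exists_walk_of_adj {x y : V} (h : G.Adj x y) : ∃ P : G.Walk x y, P.IsPath ∧ P.length = 1 ∧
    P.support = [x, y] ∧ P.edges = [s(x, y)] :=
  ⟨.cons h .nil, by simpa using h.ne, rfl, rfl, rfl⟩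

/-- The edges joining two vertices of a closed walk which are not edges of the walk. -/
def chords {u : V} (c : G.Walk u u) : Set (Sym2 V) :=
  {e | e ∈ G.edgeSet ∧ (∀ v ∈ e, v ∈ c.support) ∧ e ∉ c.edges}

lemma sum_attached_add_chords_le [Fintype V]
    (hG : ∀ (u v : V) (c₁ : G.Walk u u) (c₂ : G.Walk v v), c₁.IsCycle → c₂.IsCycle →
      c₁.length = c₂.length → {e | e ∈ c₁.edges} = {e | e ∈ c₂.edges})
    {u : V} {c : G.Walk u u} (hc : c.IsCycle) (hBG : B ≤ G)
    {C : Set V} (hC : ∀ v, v ∈ C ↔ v ∈ c.support)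
    [Fintype (offPart B C).ConnectedComponent] {r : ℕ} (hr : Fintype.card V + 1 ≤ r ^ 2)
    (hr0 : 10 ^ 40 ≤ r) :
    10 ^ 5 * (∑ D, ((attached B C D).ncard - 1) + (chords c).ncard) ≤
      (10 ^ 5 + 1) * r := by
  classical
  obtain ⟨γ, hinj, hadj, hwrap, hmem⟩ := hc.exists_enumeration
  have hℓ := hc.three_le_length
  set ℓ := c.length with hℓdef
  have hγ : ∀ i < ℓ, γ i ∈ C := fun i hi => (hC _).2 <| (hmem _).2 ⟨i, hi, rfl⟩
  let K := (offPart B C).ConnectedComponent ⊕ Sym2 V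
  let colors : Finset K := (univ : Finset (offPart B C).ConnectedComponent).disjSum
    (chords c).toFinset
  let feet : K → Finset ℕ := Sum.elim (fun D => {i ∈ range ℓ | γ i ∈ attached B C D})
    fun e => {i ∈ range ℓ | γ i ∈ e}
  let region : K → Set V :=
    Sum.elim (fun D => {v | v ∉ C ∧ (offPart B C).connectedComponentMk v = D}) fun _ => ∅
  let inc : K → ℕ → Set (Sym2 V) := Sum.elim
    (fun D x => {d | x < ℓ ∧ ∃ y, y ∉ C ∧ (offPart B C).connectedComponentMk y = D ∧
      B.Adj y (γ x) ∧ d = s(y, γ x)})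
    fun e x => {d | x < ℓ ∧ γ x ∈ e ∧ d = e ∧ e ∈ chords c}
  have hin : ∀ d ∈ c.edges, ∀ κ x, d ∉ inc κ x := by
    rintro d hd (D | e) x h
    · obtain ⟨hx, y, hy, -, -, rfl⟩ := h
      exact hy ((hC y).2 (Walk.fst_mem_support_of_mem_edges _ hd))
    · obtain ⟨-, -, rfl, h⟩ := h
      exact h.2.2 hd
  have hpath : ∀ e : K × ℕ × ℕ, ∃ k, IsEar colors feet e → k ≤ (region e.1).ncard + 1 ∧
      ∃ P : G.Walk (γ e.2.1) (γ e.2.2), P.IsPath ∧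
        P.length = k ∧ (∀ v ∈ P.support, v = γ e.2.1 ∨ v = γ e.2.2 ∨ v ∈ region e.1) ∧
        (∀ κ x, (∃ d ∈ P.edges, d ∈ inc κ x) ↔ κ = e.1 ∧ (x = e.2.1 ∨ x = e.2.2)) ∧
        s(γ (ℓ - 1), γ 0) ∉ P.edges := by
    rintro ⟨κ, i, j⟩
    by_cases he : IsEar colors feet (κ, i, j)
    swap
    · exact ⟨0, fun h => absurd h he⟩
    obtain ⟨h1, h2, h3, h4⟩ := he
    rcases κ with D | e
    · simp only [feet, Sum.elim_inl, mem_filter, mem_range] at h2 h3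
      obtain ⟨hi, -, y, hy, hyD, hyi⟩ := h2
      obtain ⟨hj, -, y', hy', hyD', hyj⟩ := h3
      obtain ⟨P, p1, p2, p3, p4, l, l1, l2, l3⟩ := exists_path_through_component (hγ j hj) hy hyj
        (ConnectedComponent.exact (hyD.trans hyD'.symm))
      refine ⟨(P.mapLe hBG).length + 1, fun _ => ⟨?_, .cons (hBG hyi.symm) (P.mapLe hBG), ?_,
        rfl, ?_, ?_, ?_⟩⟩
      · rw [Walk.length_mapLe, l2, ← List.toFinset_card_of_nodup l1, ← Set.ncard_coe_finset]
        refine Nat.succ_le_succ (Set.ncard_le_ncard (fun v hv => ?_) (Set.toFinite _))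
        rw [← hyD]
        exact l3 v (by simpa using hv)
      · rw [Walk.cons_isPath_iff, Walk.support_mapLe_eq_support]
        refine ⟨p1.mapLe hBG, fun h => ?_⟩
        rcases p2 _ h with h | h
        · exact h4.ne (hinj _ hi _ hj h)
        · exact h.1 (hγ i hi)
      · intro v hv
        rw [Walk.support_cons, List.mem_cons, Walk.support_mapLe_eq_support] at hv
        rcases hv with rfl | hv
        · exact Or.inl rfl
        · refine Or.inr ((p2 v hv).imp_right fun h => ?_)
          rwa [hyD] at h
      · intro κ x
        simp only [Walk.edges_cons, Walk.edges_mapLe_eq_edges, List.mem_cons]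
        constructor
        · rintro ⟨d, hd, hd'⟩
          rcases κ with D' | e
          · obtain ⟨hx, z, hz, rfl, hzx, rfl⟩ := hd'
            rcases hd with hd | hd
            · rw [Sym2.eq_iff] at hd
              rcases hd with ⟨rfl, -⟩ | ⟨rfl, hd⟩
              · exact absurd (hγ i hi) hz
              · exact ⟨congrArg Sum.inl hyD, Or.inl (hinj _ hx _ hi hd)⟩
            · obtain ⟨rfl, hd⟩ := (p3 z hz _ (hγ x hx)).1 hd
              exact ⟨congrArg Sum.inl hyD', Or.inr (hinj _ hx _ hj hd)⟩
          · obtain ⟨-, -, rfl, hch⟩ := hd'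
            rcases hd with rfl | hd
            · exact absurd ((hC y).2 (hch.2.1 y (by simp))) hy
            · induction d with | _ v z =>
              exact absurd hd (p4 v ((hC v).2 (hch.2.1 v (by simp))) z
                ((hC z).2 (hch.2.1 z (by simp))))
        · rintro ⟨rfl, hx | hx⟩
          · obtain rfl : i = x := hx.symm
            exact ⟨s(γ i, y), Or.inl rfl, hi, y, hy, hyD, hyi, Sym2.eq_swap⟩
          · obtain rfl : j = x := hx.symm
            exact ⟨s(y', γ j), Or.inr ((p3 y' hy' _ (hγ j hj)).2 ⟨rfl, rfl⟩), hj, y', hy', hyD',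
              hyj, rfl⟩
      · simp only [Walk.edges_cons, Walk.edges_mapLe_eq_edges, List.mem_cons, not_or]
        refine ⟨fun h => ?_, p4 _ (hγ _ (by omega)) _ (hγ _ (by omega))⟩
        exact hy ((hC y).2 (Walk.snd_mem_support_of_mem_edges c (h ▸ hwrap)))
    · simp only [feet, Sum.elim_inr, mem_filter, mem_range] at h2 h3
      obtain ⟨hi, h2⟩ := h2
      obtain ⟨hj, h3⟩ := h3
      have hch : e ∈ chords c :=
        Set.mem_toFinset.1 (inr_mem_disjSum.1 h1)
      have hne : γ i ≠ γ j := fun h => h4.ne (hinj _ hi _ hj h)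
      obtain rfl : e = s(γ i, γ j) := (Sym2.mem_and_mem_iff hne).1 ⟨h2, h3⟩
      obtain ⟨P, p1, p2, p3, p4⟩ := exists_walk_of_adj (show G.Adj (γ i) (γ j) from hch.1)
      refine ⟨1, fun _ => ⟨Nat.le_add_left _ _, P, p1, p2, ?_, ?_, ?_⟩⟩
      · intro v hv
        simp only [p3, List.mem_cons, List.not_mem_nil, or_false] at hv
        exact hv.imp_right Or.inl
      · intro κ x
        simp only [p4, List.mem_singleton, exists_eq_left]
        constructor
        · intro hd
          rcases κ with D' | e
          · obtain ⟨hx, z, hz, -, -, hd⟩ := hd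
            rw [Sym2.eq_iff] at hd
            rcases hd with ⟨rfl, -⟩ | ⟨-, rfl⟩
            · exact absurd (hγ i hi) hz
            · exact absurd (hγ j hj) hz
          · obtain ⟨hx, hxe, rfl, -⟩ := hd
            refine ⟨rfl, (Sym2.mem_iff.1 hxe).imp (hinj _ hx _ hi) (hinj _ hx _ hj)⟩
        · rintro ⟨rfl, hx | hx⟩
          · obtain rfl : i = x := hx.symm
            exact ⟨hi, h2, rfl, hch⟩
          · obtain rfl : j = x := hx.symm
            exact ⟨hj, h3, rfl, hch⟩
      · simp only [p4, List.mem_singleton]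
        exact fun h => hch.2.2 (h ▸ hwrap)
  choose len hlen hpath using hpath
  let F : EarFamily G K :=
    { ℓ := ℓ
      γ := γ
      colors := colors
      feet := feet
      region := region
      inc := inc
      len := len
      inj := fun hi hj => hinj _ hi _ hj
      adj := fun hi => c.edges_subset_edgeSet (hadj _ hi)
      adj_wrap := c.edges_subset_edgeSet hwrap
      two_lt := hℓ
      feet_lt := by
        rintro (D | e) - x hx
        · simp only [feet, Sum.elim_inl, mem_filter, mem_range] at hx
          exact hx.1
        · simp only [feet, Sum.elim_inr, mem_filter, mem_range] at hx
          exact hx.1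
      region_disjoint := by
        rintro (D | e) - (D' | e') - hne v hv hv'
        · exact hne (congrArg Sum.inl (hv.2.symm.trans hv'.2))
        · exact hv'
        · exact hv
        · exact hv
      region_off := by
        rintro (D | e) - v hv i hi rfl
        · exact hv.1 (hγ i hi)
        · exact hv
      inc_adj := fun hi => hin _ (hadj _ hi)
      inc_wrap := hin _ hwrap
      exists_path := hpath }
  have key := EarSystem.sum_feet_sub_one_le (S := F.toEarSystem hG hlen) hr hr0
  refine le_trans (Nat.mul_le_mul_left _ ?_) key
  change _ ≤ ∑ κ ∈ colors, (#(feet κ) - 1)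
  rw [sum_disjSum]
  refine add_le_add (sum_le_sum fun D _ => Nat.sub_le_sub_right ?_ 1) ?_
  · have h : attached B C D ⊆ ↑((feet (Sum.inl D)).image γ) := by
      intro x hx
      obtain ⟨i, hi, rfl⟩ := (hmem x).1 ((hC x).1 hx.1)
      simp only [coe_image, Set.mem_image, mem_coe]
      exact ⟨i, by simp [feet, hi, hx], rfl⟩
    refine (Set.ncard_le_ncard h (Set.toFinite _)).trans ?_
    rw [Set.ncard_coe_finset]
    exact card_image_le
  · rw [Set.ncard_eq_toFinset_card', card_eq_sum_ones]
    refine sum_le_sum fun e he => ?_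
    rw [Set.mem_toFinset] at he
    induction e with | _ v w =>
    obtain ⟨i, hi, rfl⟩ := (hmem v).1 (he.2.1 v (by simp))
    obtain ⟨j, hj, rfl⟩ := (hmem w).1 (he.2.1 w (by simp))
    have hne : i ≠ j := fun h => he.1.ne (congrArg γ h)
    have h : {i, j} ⊆ feet (Sum.inr s(γ i, γ j)) := by
      simp [feet, insert_subset_iff, hi, hj]
    have := card_le_card h
    rw [card_pair hne] at this
    omega

end EarsOfCycle

section LongCycle

open Finset SimpleGraph

variable {V : Type*} {G : SimpleGraph V}

lemma exists_cyclesVisitTwice [DecidableEq V]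
    (hG : ∀ (u v : V) (c₁ : G.Walk u u) (c₂ : G.Walk v v), c₁.IsCycle → c₂.IsCycle →
      c₁.length = c₂.length → {e | e ∈ c₁.edges} = {e | e ∈ c₂.edges})
    (C : Set V) (U : Finset (Sym2 V)) (hU : ∀ e ∈ U, e ∈ G.edgeSet) (k : ℕ) (hk : 1 ≤ k)
    (hUk : #U ≤ (2 * k) ^ 2) :
    ∃ F ⊆ U, CyclesVisitTwice (fromEdgeSet (↑(U \ F) : Set (Sym2 V))) C ∧
      (#F : ℝ) ≤ (2 - 1 / 1000) * (2 * k) := by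
  classical
  let 𝒜 : Finset (Finset (Sym2 V)) := U.powerset.filter fun A =>
    ∃ (v : V) (c : G.Walk v v), c.IsCycle ∧ c.edges.toFinset = A ∧
      ∀ x ∈ c.support, ∀ y ∈ c.support, x ∈ C → y ∈ C → x = y
  have h1 : ∀ A ∈ 𝒜, A.Nonempty := by
    intro A hA
    obtain ⟨-, v, c, hc, rfl, -⟩ := mem_filter.1 hA
    rw [List.toFinset_nonempty_iff]
    intro h
    have h1 := hc.three_le_length
    rw [← c.length_edges, h] at h1
    simp at h1
  have h2 : ∀ A ∈ 𝒜, ∀ A' ∈ 𝒜, #A = #A' → A = A' := by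
    intro A hA A' hA' hAA
    obtain ⟨-, v, c, hc, rfl, -⟩ := mem_filter.1 hA
    obtain ⟨-, v', c', hc', rfl, -⟩ := mem_filter.1 hA'
    rw [List.toFinset_card_of_nodup hc.isTrail.edges_nodup,
      List.toFinset_card_of_nodup hc'.isTrail.edges_nodup, Walk.length_edges,
      Walk.length_edges] at hAA
    ext e
    simpa using Set.ext_iff.1 (hG v v' c c' hc hc' hAA) e
  obtain ⟨F, hFU, hF, hcard⟩ := exists_transversal U k hk hUk 𝒜
    (fun A hA => mem_powerset.1 (mem_filter.1 hA).1) h1 h2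
  refine ⟨F, hFU, fun v p hp => ?_, hcard⟩
  by_contra! hcon
  have hle : fromEdgeSet (↑(U \ F) : Set (Sym2 V)) ≤ G := by
    intro x y h
    rw [fromEdgeSet_adj, coe_sdiff] at h
    exact hU _ h.1.1
  have hmem : ∀ e ∈ p.edges, e ∈ U ∧ e ∉ F := by
    intro e he
    have := p.edges_subset_edgeSet he
    rw [edgeSet_fromEdgeSet, coe_sdiff] at this
    exact this.1
  refine hF p.edges.toFinset (mem_filter.2 ⟨mem_powerset.2 fun e he => ?_, v, p.mapLe hle,
    hp.mapLe hle, ?_, ?_⟩) (Finset.disjoint_left.2 fun e he => ?_)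
  · exact (hmem e (by simpa using he)).1
  · simp only [Walk.edges_mapLe_eq_edges]
  · rw [Walk.support_mapLe_eq_support]
    exact fun x hx y hy hxC hyC => hcon x hx y hy hxC hyC
  · exact (hmem e (by simpa using he)).2

/-- The edges of `G` are few more than its vertices, up to the size of a transversal `f` of the
cycles that are almost disjoint from a given one. -/
lemma exists_card_edges_le [Fintype V]
    (hG : ∀ (u v : V) (c₁ : G.Walk u u) (c₂ : G.Walk v v), c₁.IsCycle → c₂.IsCycle →
      c₁.length = c₂.length → {e | e ∈ c₁.edges} = {e | e ∈ c₂.edges})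
    {u : V} {c : G.Walk u u} (hc : c.IsCycle) {r : ℕ} (hr : Fintype.card V + 1 ≤ r ^ 2)
    (hr0 : 10 ^ 40 ≤ r) : ∃ m f t : ℕ, m + c.length ≤ Fintype.card V + f + t ∧
      G.edgeSet.ncard ≤ Fintype.card V + f + t ∧
      10 ^ 5 * t ≤ (10 ^ 5 + 1) * r ∧ (f : ℝ) ≤ (2 - 1 / 1000) * (Nat.sqrt m + 2) := by
  classical
  set C : Set V := {v | v ∈ c.support} with hC
  let U : Finset (Sym2 V) := {e ∈ G.edgeSet | ∃ v ∈ e, v ∉ C}.toFinset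
  have hU : ∀ e, e ∈ U ↔ e ∈ G.edgeSet ∧ ∃ v ∈ e, v ∉ C := fun e => by simp [U]
  have hUs : #U ≤ (2 * (Nat.sqrt #U / 2 + 1)) ^ 2 :=
    (Nat.lt_succ_sqrt' _).le.trans (Nat.pow_le_pow_left (by omega) 2)
  obtain ⟨F, hFU, hF, hcard⟩ := exists_cyclesVisitTwice hG C U (fun e he => ((hU e).1 he).1) _
    (Nat.le_add_left 1 _) hUs
  set B : SimpleGraph V := fromEdgeSet (↑(U \ F) : Set (Sym2 V)) with hB
  have hBadj : ∀ x y, B.Adj x y → s(x, y) ∈ U := by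
    intro x y h
    rw [hB, fromEdgeSet_adj, coe_sdiff] at h
    exact h.1.1
  have h1 := hF.ncard_edgeSet_add_le fun x y h => by
    obtain ⟨v, hv, hv'⟩ := ((hU _).1 (hBadj x y h)).2
    rcases Sym2.mem_iff.1 hv with rfl | rfl
    exacts [Or.inl hv', Or.inr hv']
  have h2 := sum_attached_add_chords_le hG hc (B := B)
    (fun x y h => ((hU _).1 (hBadj x y h)).1) (C := C) (fun _ => Iff.rfl) hr hr0
  have h3 : c.length ≤ C.ncard := by
    obtain ⟨γ, hinj, -, -, hmem⟩ := hc.exists_enumeration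
    have h : (↑((range c.length).image γ) : Set V) ⊆ C := by
      intro v hv
      simp only [coe_image, Set.mem_image, mem_coe, mem_range] at hv
      exact (hmem v).2 hv
    have h' := Set.ncard_le_ncard h (Set.toFinite _)
    rwa [Set.ncard_coe_finset, card_image_of_injOn, card_range] at h'
    exact fun i hi j hj => hinj i (by simpa using hi) j (by simpa using hj)
  have h4 : #U ≤ #F + B.edgeSet.ncard := by
    rw [← card_sdiff_add_card_eq_card hFU, add_comm, ← Set.ncard_coe_finset (U \ F)]
    refine Nat.add_le_add_left (Set.ncard_le_ncard (t := B.edgeSet) (fun e he => ?_)) _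
    rw [hB, edgeSet_fromEdgeSet]
    exact ⟨he, G.not_isDiag_of_mem_edgeSet ((hU e).1 (mem_sdiff.1 he).1).1⟩
  have h5 : G.edgeSet.ncard ≤ #U + (chords c).ncard + c.length := by
    have h : G.edgeSet ⊆ ↑U ∪ chords c ∪ ↑c.edges.toFinset := by
      intro e he
      by_cases h6 : ∃ v ∈ e, v ∉ C
      · exact Or.inl (Or.inl ((hU e).2 ⟨he, h6⟩))
      by_cases h7 : e ∈ c.edges
      · exact Or.inr (by simpa using h7)
      · push Not at h6
        exact Or.inl (Or.inr ⟨he, h6, h7⟩)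
    refine (Set.ncard_le_ncard h (Set.toFinite _)).trans ((Set.ncard_union_le _ _).trans ?_)
    gcongr
    · refine (Set.ncard_union_le _ _).trans ?_
      rw [Set.ncard_coe_finset]
    · rw [Set.ncard_coe_finset, ← Walk.length_edges]
      exact List.toFinset_card_le _
  refine ⟨#U, #F, _, ?_, ?_, h2, hcard.trans ?_⟩
  · omega
  · omega
  · have : 2 * (Nat.sqrt #U / 2 + 1) ≤ Nat.sqrt #U + 2 := by omega
    have : ((2 * (Nat.sqrt #U / 2 + 1) : ℕ) : ℝ) ≤ (Nat.sqrt #U + 2 : ℕ) := by exact_mod_cast this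
    push_cast at this ⊢
    linarith

end LongCycle

section MainTheorem

open Finset SimpleGraph

lemma card_edges_le_of_bounds {n m f t r ℓ E : ℕ} (hn : 10 ^ 81 ≤ n) (hr : r = Nat.sqrt n + 1)
    (h1 : m + ℓ ≤ n + f + t) (h2 : E ≤ n + f + t) (h3 : 10 ^ 5 * t ≤ (10 ^ 5 + 1) * r)
    (h4 : (f : ℝ) ≤ (2 - 1 / 1000) * (Nat.sqrt m + 2)) (hℓ : (15 / 16 : ℝ) * n < ℓ) :
    (E : ℝ) ≤ n + (3 / 2 : ℝ) * Real.sqrt n := by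
  set x := Real.sqrt n with hx
  have hx2 : x ^ 2 = n := Real.sq_sqrt (Nat.cast_nonneg n)
  have hx0 : 0 ≤ x := Real.sqrt_nonneg _
  have hxl : (10 : ℝ) ^ 40 ≤ x := by
    refine Real.le_sqrt_of_sq_le ?_
    have : ((10 ^ 81 : ℕ) : ℝ) ≤ n := by exact_mod_cast hn
    norm_num at this ⊢
    linarith
  have hrx : (r : ℝ) ≤ x + 1 := by
    rw [hr]
    push_cast
    gcongr
    exact Real.nat_sqrt_le_real_sqrt
  set y : ℝ := (Nat.sqrt m : ℝ) with hy
  have hy0 : 0 ≤ y := Nat.cast_nonneg _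
  have hym : y ^ 2 ≤ m := by
    rw [hy]
    exact_mod_cast Nat.sqrt_le' m
  have h1' : (m : ℝ) + ℓ ≤ n + f + t := by exact_mod_cast h1
  have h2' : (E : ℝ) ≤ n + f + t := by exact_mod_cast h2
  have h3' : (10 : ℝ) ^ 5 * t ≤ (10 ^ 5 + 1) * r := by exact_mod_cast h3
  have hyx : y ≤ x / 4 + 4 := by
    by_contra! hcon
    nlinarith
  norm_num at h3' hxl
  linarith

end MainTheorem

/-- For all sufficiently large `n`: if a simple graph on `n` vertices has no
repeated cycle lengths and contains a cycle of length strictly greater than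
`(15/16) * n`, then its number of edges is at most `n + (3/2) * √n`. -/
theorem stmt_1 :
    ∃ N : ℕ, ∀ n : ℕ, N ≤ n →
      ∀ G : SimpleGraph (Fin n),
        NoRepeatedCycleLengths G →
        (∃ (u : Fin n) (c : G.Walk u u), c.IsCycle ∧
          (15 / 16 : ℝ) * n < (c.length : ℝ)) →
        (G.edgeSet.ncard : ℝ) ≤ n + (3 / 2 : ℝ) * Real.sqrt n := by
  refine ⟨10 ^ 81, fun n hn G hG ⟨u, c, hc, hlen⟩ => ?_⟩
  have hroot : 10 ^ 40 ≤ Nat.sqrt n :=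
    Nat.le_sqrt'.2 (le_trans (by norm_num) hn)
  obtain ⟨m, f, t, h₁, h₂, h₃, h₄⟩ := exists_card_edges_le hG hc (r := Nat.sqrt n + 1)
    (by rw [Fintype.card_fin]; exact Nat.lt_succ_sqrt' n) (by lia)
  rw [Fintype.card_fin] at h₁ h₂
  exact card_edges_le_of_bounds hn rfl h₁ h₂ h₃ h₄ hlen
end

section
/- For all sufficiently large n, there exists a simple graph G on n vertices in which any two cycles have different lengths and whose number of edges is strictly greater than n + (3/2)·√n. -/
/-- The vertex at distance `t` from the hub `none` along the path of length `p` in block `i`;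
all the paths of block `i` end at the vertex `some (i, 0, 0)`. -/
def pathVertex {ι : Type*} (i : ι) (p t : ℕ) : Option (ι × ℕ × ℕ) :=
  if t = 0 then none else if t < p then some (i, p, t) else some (i, 0, 0)

/-- The edge joining the vertices at distances `t` and `t + 1` from the hub along a path. -/
def pathEdge {ι : Type*} (i : ι) (p t : ℕ) : Sym2 (Option (ι × ℕ × ℕ)) :=
  s(pathVertex i p t, pathVertex i p (t + 1))

/-- A hub together with blocks indexed by `ι`; block `i` consists of internally disjoint paths
from the hub to a common end, one path of length `p` for each `p ∈ P i`. -/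
def thetaGraph {ι : Type*} (P : ι → Finset ℕ) : SimpleGraph (Option (ι × ℕ × ℕ)) :=
  SimpleGraph.fromEdgeSet {e | ∃ i, ∃ p ∈ P i, ∃ t < p, e = pathEdge i p t}

section

variable {ι : Type*} {P : ι → Finset ℕ}

lemma pathVertex_zero (i : ι) (p : ℕ) : pathVertex i p 0 = none := by simp [pathVertex]

lemma pathVertex_self (i : ι) {p : ℕ} (hp : 2 ≤ p) : pathVertex i p p = some (i, 0, 0) := by
  simp [pathVertex]; omega

lemma pathVertex_ne {i : ι} {p t : ℕ} (hp : 2 ≤ p) (ht : t < p) :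
    pathVertex i p t ≠ pathVertex i p (t + 1) := by
  unfold pathVertex
  split_ifs <;> simp <;> omega

lemma pathVertex_inj {i j : ι} {p r t u : ℕ} (ht : 0 < t) (htp : t < p)
    (h : pathVertex i p t = pathVertex j r u) : i = j ∧ p = r ∧ t = u := by
  unfold pathVertex at h
  split_ifs at h <;> simp at h <;> grind

lemma pathEdge_inj {i j : ι} {p r t u : ℕ} (hp : 2 ≤ p) (ht : t < p) (hu : u < r)
    (h : pathEdge i p t = pathEdge j r u) : i = j ∧ p = r ∧ t = u := by
  unfold pathEdge pathVertex at h
  split_ifs at h <;> simp at h <;> grind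

lemma thetaGraph_adj (hP : ∀ i, ∀ p ∈ P i, 2 ≤ p) {x y : Option (ι × ℕ × ℕ)} :
    (thetaGraph P).Adj x y ↔ ∃ i, ∃ p ∈ P i, ∃ t < p, s(x, y) = pathEdge i p t := by
  simp only [thetaGraph, SimpleGraph.fromEdgeSet_adj, Set.mem_ofPred_eq, and_iff_left_iff_imp]
  rintro ⟨i, p, hp, t, ht, h⟩ rfl
  have := pathVertex_ne (i := i) (hP i p hp) ht
  simp only [pathEdge, Sym2.eq_iff] at h
  grind

lemma adj_interior (hP : ∀ i, ∀ p ∈ P i, 2 ≤ p) {i : ι} {p t : ℕ} (htp : t + 1 < p)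
    {y : Option (ι × ℕ × ℕ)} (h : (thetaGraph P).Adj (pathVertex i p (t + 1)) y) :
    y = pathVertex i p t ∨ y = pathVertex i p (t + 2) := by
  obtain ⟨j, r, hr, u, hu, he⟩ := (thetaGraph_adj hP).1 h
  simp only [pathEdge, Sym2.eq_iff] at he
  rcases he with ⟨he, rfl⟩ | ⟨he, rfl⟩
  · obtain ⟨rfl, rfl, rfl⟩ := pathVertex_inj (by omega) htp he
    exact Or.inr rfl
  · obtain ⟨rfl, rfl, h⟩ := pathVertex_inj (by omega) htp he
    obtain rfl : t = u := by omega
    exact Or.inl rfl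

lemma adj_end (hP : ∀ i, ∀ p ∈ P i, 2 ≤ p) {i : ι} {y : Option (ι × ℕ × ℕ)}
    (h : (thetaGraph P).Adj (some (i, 0, 0)) y) :
    ∃ p ∈ P i, y = pathVertex i p (p - 1) := by
  obtain ⟨j, r, hr, u, hu, he⟩ := (thetaGraph_adj hP).1 h
  have := hP j r hr
  simp only [pathEdge, Sym2.eq_iff] at he
  rcases he with ⟨he, rfl⟩ | ⟨he, rfl⟩
  · unfold pathVertex at he
    split_ifs at he
    all_goals simp at he
    all_goals omega
  · have : u = r - 1 ∧ i = j := by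
      unfold pathVertex at he
      split_ifs at he <;> simp at he <;> grind
    obtain ⟨rfl, rfl⟩ := this
    exact ⟨r, hr, rfl⟩

/-- The edge set of the path of length `p` in block `i`. -/
noncomputable def pathEdges (i : ι) (p : ℕ) : Finset (Sym2 (Option (ι × ℕ × ℕ))) :=
  open Classical in (Finset.range p).image (pathEdge i p)

lemma mem_pathEdges {i : ι} {p : ℕ} {e : Sym2 (Option (ι × ℕ × ℕ))} :
    e ∈ pathEdges i p ↔ ∃ t < p, pathEdge i p t = e := by
  simp [pathEdges]

lemma card_pathEdges (i : ι) {p : ℕ} (hp : 2 ≤ p) : (pathEdges i p).card = p := by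
  classical
  rw [pathEdges, Finset.card_image_of_injOn, Finset.card_range]
  intro t ht u hu h
  exact (pathEdge_inj hp (by simpa using ht) (by simpa using hu) h).2.2

lemma disjoint_pathEdges {i j : ι} {p r : ℕ} (hr : 2 ≤ r) (h : i = j → p ≠ r) :
    Disjoint (pathEdges i p) (pathEdges j r) := by
  rw [Finset.disjoint_left]
  intro e he he'
  obtain ⟨t, ht, rfl⟩ := mem_pathEdges.1 he
  obtain ⟨u, hu, h'⟩ := mem_pathEdges.1 he'
  have := pathEdge_inj hr hu ht h'
  exact h this.1.symm this.2.1.symm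

lemma mem_edges_of_eq_or_eq {V : Type*} {G : SimpleGraph V} {u : V} {c : G.Walk u u}
    (hc : c.IsCycle) {x a : V} (ha : s(x, a) ∈ c.edges) {b b' : V}
    (h : ∀ y, s(x, y) ∈ c.edges → y = b ∨ y = b') :
    s(x, b) ∈ c.edges ∧ s(x, b') ∈ c.edges := by
  have hx := hc.ncard_neighborSet_toSubgraph_eq_two (c.fst_mem_support_of_mem_edges ha)
  have hn : c.toSubgraph.neighborSet x = {y | s(x, y) ∈ c.edges} := by
    ext y
    simp [SimpleGraph.Walk.adj_toSubgraph_iff_mem_edges]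
  rw [hn] at hx
  have hs : {y | s(x, y) ∈ c.edges} ⊆ {b, b'} := fun y hy => by simpa using h y hy
  have he := Set.eq_of_subset_of_ncard_le hs
    (by rw [hx]; exact (Set.ncard_insert_le _ _).trans (by simp))
  have hb : b ∈ {y | s(x, y) ∈ c.edges} := by rw [he]; simp
  have hb' : b' ∈ {y | s(x, y) ∈ c.edges} := by rw [he]; simp
  exact ⟨hb, hb'⟩

lemma exists_other_edge {V : Type*} {G : SimpleGraph V} {u : V} {c : G.Walk u u}
    (hc : c.IsCycle) {x a : V} (ha : s(x, a) ∈ c.edges) :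
    ∃ b, b ≠ a ∧ s(x, b) ∈ c.edges := by
  by_contra! h
  have hx := hc.ncard_neighborSet_toSubgraph_eq_two (c.fst_mem_support_of_mem_edges ha)
  have hn : c.toSubgraph.neighborSet x = {a} := by
    ext y
    simp only [SimpleGraph.Subgraph.mem_neighborSet,
      SimpleGraph.Walk.adj_toSubgraph_iff_mem_edges, Set.mem_singleton_iff]
    constructor
    · intro hy
      by_contra hne
      exact h y hne hy
    · rintro rfl
      exact ha
  rw [hn] at hx
  simp at hx

lemma eq_or_eq_of_mem_edges {V : Type*} {G : SimpleGraph V} {u : V} {c : G.Walk u u}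
    (hc : c.IsCycle) {x a b y : V} (ha : s(x, a) ∈ c.edges) (hb : s(x, b) ∈ c.edges)
    (hab : a ≠ b) (hy : s(x, y) ∈ c.edges) : y = a ∨ y = b := by
  have hx := hc.ncard_neighborSet_toSubgraph_eq_two (c.fst_mem_support_of_mem_edges ha)
  have hs : ({a, b} : Set V) ⊆ c.toSubgraph.neighborSet x := by
    rintro z (rfl | rfl) <;> simpa [SimpleGraph.Walk.adj_toSubgraph_iff_mem_edges]
  have he := Set.eq_of_subset_of_ncard_le hs (by rw [hx, Set.ncard_pair hab])
    (Set.finite_of_ncard_ne_zero (by rw [hx]; norm_num))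
  have : y ∈ c.toSubgraph.neighborSet x := by
    simpa [SimpleGraph.Walk.adj_toSubgraph_iff_mem_edges]
  rw [← he] at this
  simpa using this

lemma pathEdge_mem_edges_iff (hP : ∀ i, ∀ p ∈ P i, 2 ≤ p) {v : Option (ι × ℕ × ℕ)}
    {c : (thetaGraph P).Walk v v} (hc : c.IsCycle) {i : ι} {p t : ℕ} (ht : t < p) :
    pathEdge i p t ∈ c.edges ↔ pathEdge i p 0 ∈ c.edges := by
  induction t with
  | zero => rfl
  | succ t ih =>
    rw [← ih (by omega)]
    have key : ∀ a, s(pathVertex i p (t + 1), a) ∈ c.edges →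
        s(pathVertex i p (t + 1), pathVertex i p t) ∈ c.edges ∧
          s(pathVertex i p (t + 1), pathVertex i p (t + 2)) ∈ c.edges := fun a ha =>
      mem_edges_of_eq_or_eq hc ha fun y hy => adj_interior hP ht (c.adj_of_mem_edges hy)
    constructor
    · intro h
      rw [pathEdge, Sym2.eq_swap]
      exact (key _ h).1
    · intro h
      rw [pathEdge, Sym2.eq_swap] at h
      exact (key _ h).2

/-- Every cycle of a `thetaGraph` is the union of two paths of the same block. -/
lemma exists_paths_of_isCycle (hP : ∀ i, ∀ p ∈ P i, 2 ≤ p) {v : Option (ι × ℕ × ℕ)}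
    {c : (thetaGraph P).Walk v v} (hc : c.IsCycle) :
    ∃ i, ∃ p ∈ P i, ∃ r ∈ P i, p < r ∧ c.length = p + r ∧
      {e | e ∈ c.edges} = (pathEdges i p ∪ pathEdges i r : Set (Sym2 (Option (ι × ℕ × ℕ)))) := by
  classical
  have hedge : ∀ e ∈ c.edges, ∃ j, ∃ q ∈ P j, ∃ t < q,
      e = pathEdge j q t ∧ pathEdge j q 0 ∈ c.edges := by
    intro e he
    induction e with | _ x y =>
    obtain ⟨j, q, hq, t, ht, h⟩ := (thetaGraph_adj hP).1 (c.adj_of_mem_edges he)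
    exact ⟨j, q, hq, t, ht, h, (pathEdge_mem_edges_iff hP hc ht).1 (h ▸ he)⟩
  have hlast : ∀ j, ∀ q ∈ P j,
      pathEdge j q (q - 1) = s(some (j, 0, 0), pathVertex j q (q - 1)) := by
    intro j q hq
    have := hP j q hq
    rw [pathEdge, Nat.sub_add_cancel (by omega), pathVertex_self j this, Sym2.eq_swap]
  obtain ⟨e, he⟩ : ∃ e, e ∈ c.edges := by
    apply List.exists_mem_of_ne_nil
    intro h
    have := hc.three_le_length
    rw [← c.length_edges, h] at this
    simp at this
  obtain ⟨i, p, hp, -, -, -, hp0⟩ := hedge e he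
  have hp2 := hP i p hp
  have hpl := (pathEdge_mem_edges_iff hP hc (Nat.sub_lt (by omega) one_pos)).2 hp0
  rw [hlast i p hp] at hpl
  obtain ⟨b, hb, hb'⟩ := exists_other_edge hc hpl
  obtain ⟨r, hr, rfl⟩ := adj_end hP (c.adj_of_mem_edges hb')
  have hr2 := hP i r hr
  have hr0 : pathEdge i r 0 ∈ c.edges := by
    rw [← hlast i r hr] at hb'
    exact (pathEdge_mem_edges_iff hP hc (Nat.sub_lt (by omega) one_pos)).1 hb'
  have hpr : p ≠ r := by
    rintro rfl
    exact hb rfl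
  have hset : {e | e ∈ c.edges} =
      (pathEdges i p ∪ pathEdges i r : Set (Sym2 (Option (ι × ℕ × ℕ)))) := by
    ext e
    simp only [Set.mem_ofPred_eq, Set.mem_union, Finset.mem_coe, mem_pathEdges]
    constructor
    · intro he
      obtain ⟨j, q, hq, t, ht, rfl, hq0⟩ := hedge e he
      have hq2 := hP j q hq
      have hne : pathVertex i p 1 ≠ pathVertex i r 1 := fun h =>
        hpr (pathVertex_inj one_pos (by omega) h).2.1
      simp only [pathEdge, pathVertex_zero, zero_add] at hp0 hr0 hq0
      rcases eq_or_eq_of_mem_edges hc hp0 hr0 hne hq0 with h | h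
      · obtain ⟨rfl, rfl, -⟩ := pathVertex_inj one_pos (by omega) h
        exact Or.inl ⟨t, ht, rfl⟩
      · obtain ⟨rfl, rfl, -⟩ := pathVertex_inj one_pos (by omega) h
        exact Or.inr ⟨t, ht, rfl⟩
    · rintro (⟨t, ht, rfl⟩ | ⟨t, ht, rfl⟩)
      · exact (pathEdge_mem_edges_iff hP hc ht).2 hp0
      · exact (pathEdge_mem_edges_iff hP hc ht).2 hr0
  have hlen : c.length = p + r := by
    have h1 : c.edges.toFinset = pathEdges i p ∪ pathEdges i r := by
      ext e
      simpa using Set.ext_iff.1 hset e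
    rw [← c.length_edges, ← List.toFinset_card_of_nodup hc.edges_nodup, h1,
      Finset.card_union_of_disjoint (disjoint_pathEdges hr2 fun _ => hpr),
      card_pathEdges i hp2, card_pathEdges i hr2]
  rcases lt_or_gt_of_ne hpr with h | h
  · exact ⟨i, p, hp, r, hr, h, hlen, hset⟩
  · exact ⟨i, r, hr, p, hp, h, by rw [hlen, add_comm], by rw [hset, Set.union_comm]⟩

lemma noRepeatedCycleLengths_thetaGraph (hP : ∀ i, ∀ p ∈ P i, 2 ≤ p)
    (hsum : ∀ i j, ∀ p ∈ P i, ∀ r ∈ P i, ∀ p' ∈ P j, ∀ r' ∈ P j, p < r → p' < r' →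
      p + r = p' + r' → i = j ∧ p = p') :
    NoRepeatedCycleLengths (thetaGraph P) := by
  intro u v c₁ c₂ h₁ h₂ hlen
  obtain ⟨i, p, hp, r, hr, hpr, hl, hs⟩ := exists_paths_of_isCycle hP h₁
  obtain ⟨j, p', hp', r', hr', hpr', hl', hs'⟩ := exists_paths_of_isCycle hP h₂
  obtain ⟨rfl, rfl⟩ := hsum i j p hp r hr p' hp' r' hr' hpr hpr' (by omega)
  obtain rfl : r = r' := by omega
  rw [hs, hs']

lemma ncard_edgeSet_thetaGraph [Fintype ι] (hP : ∀ i, ∀ p ∈ P i, 2 ≤ p) :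
    (thetaGraph P).edgeSet.ncard = ∑ i, ∑ p ∈ P i, p := by
  classical
  have h : (thetaGraph P).edgeSet =
      ((Finset.univ.sigma P).biUnion fun q => pathEdges q.1 q.2 :
        Finset (Sym2 (Option (ι × ℕ × ℕ)))) := by
    ext e
    induction e with | _ x y =>
    rw [SimpleGraph.mem_edgeSet, thetaGraph_adj hP]
    simp [mem_pathEdges, eq_comm]
  rw [h, Set.ncard_coe_finset, Finset.card_biUnion, Finset.sum_sigma]
  · exact Finset.sum_congr rfl fun i _ => Finset.sum_congr rfl fun p hp =>
      card_pathEdges i (hP i p hp)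
  · rintro ⟨i, p⟩ - ⟨j, r⟩ hr hne
    have hr := (Finset.mem_sigma.1 (Finset.mem_coe.1 hr)).2
    refine disjoint_pathEdges (hP j r hr) ?_
    rintro rfl rfl
    exact hne rfl

/-- The vertices of `thetaGraph P` that lie on one of its paths. -/
noncomputable def thetaVerts [Fintype ι] (P : ι → Finset ℕ) : Finset (Option (ι × ℕ × ℕ)) :=
  open Classical in Finset.insertNone
    (Finset.univ.biUnion fun i => insert (i, 0, 0)
      ((P i).biUnion fun p => (Finset.Ico 1 p).image fun t => (i, p, t)))

lemma card_thetaVerts [Fintype ι] (P : ι → Finset ℕ) :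
    (thetaVerts P).card = ∑ i, (∑ p ∈ P i, (p - 1) + 1) + 1 := by
  classical
  rw [thetaVerts, Finset.card_insertNone, Finset.card_biUnion]
  · congr 1
    refine Finset.sum_congr rfl fun i _ => ?_
    rw [Finset.card_insert_of_notMem, Finset.card_biUnion]
    · congr 1
      refine Finset.sum_congr rfl fun p _ => ?_
      rw [Finset.card_image_of_injective _ (fun a b h => by simpa using h), Nat.card_Ico]
    · intro p _ r _ hne
      simp only [Finset.disjoint_left, Finset.mem_image]
      grind
    · simp
  · intro i _ j _ hne
    simp only [Finset.disjoint_left, Finset.mem_insert, Finset.mem_biUnion, Finset.mem_image]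
    grind

lemma pathVertex_mem_thetaVerts [Fintype ι] {i : ι} {p t : ℕ} (hp : p ∈ P i) :
    pathVertex i p t ∈ thetaVerts P := by
  unfold pathVertex thetaVerts
  split_ifs with h0 hlt
  · simp
  · simp; grind
  · simp

end

lemma NoRepeatedCycleLengths.comap {V W : Type*} {G : SimpleGraph W}
    (hG : NoRepeatedCycleLengths G) (f : V ↪ W) : NoRepeatedCycleLengths (G.comap f) := by
  intro u v c₁ c₂ h₁ h₂ hlen
  let φ : G.comap f →g G := (SimpleGraph.Embedding.comap f G).toHom
  have hφ : Function.Injective φ := f.injective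
  have := hG _ _ (c₁.map φ) (c₂.map φ) (h₁.map hφ) (h₂.map hφ) (by simpa using hlen)
  ext e
  have he := Set.ext_iff.1 this (e.map φ)
  simpa [SimpleGraph.Walk.edges_map, List.mem_map, (Sym2.map.injective hφ).eq_iff] using he

lemma ncard_edgeSet_comap {V W : Type*} {G : SimpleGraph W} (f : V ↪ W)
    (hf : ∀ x y, G.Adj x y → x ∈ Set.range f) :
    (G.comap f).edgeSet.ncard = G.edgeSet.ncard := by
  rw [← Set.ncard_image_of_injective _ (Sym2.map.injective f.injective)]
  congr 1
  ext e
  constructor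
  · rintro ⟨e, he, rfl⟩
    induction e with | _ x y => simpa using he
  · induction e with | _ x y =>
    intro h
    obtain ⟨a, rfl⟩ := hf x y h
    obtain ⟨b, rfl⟩ := hf y _ (SimpleGraph.Adj.symm h)
    exact ⟨s(a, b), by simpa using h, rfl⟩

/-- A system of path lengths whose sums of two distinct members of a block are all different
yields a graph without repeated cycle lengths. -/
lemma exists_noRepeatedCycleLengths {ι : Type*} [Fintype ι] {P : ι → Finset ℕ}
    (hP : ∀ i, ∀ p ∈ P i, 2 ≤ p)
    (hsum : ∀ i j, ∀ p ∈ P i, ∀ r ∈ P i, ∀ p' ∈ P j, ∀ r' ∈ P j, p < r → p' < r' →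
      p + r = p' + r' → i = j ∧ p = p') {n : ℕ}
    (hn : ∑ i, (∑ p ∈ P i, (p - 1) + 1) + 1 = n) :
    ∃ G : SimpleGraph (Fin n), NoRepeatedCycleLengths G ∧
      G.edgeSet.ncard = ∑ i, ∑ p ∈ P i, p := by
  rw [← card_thetaVerts] at hn
  let f : Fin n ↪ Option (ι × ℕ × ℕ) :=
    ((thetaVerts P).equivFinOfCardEq hn).symm.toEmbedding.trans (Function.Embedding.subtype _)
  refine ⟨(thetaGraph P).comap f, (noRepeatedCycleLengths_thetaGraph hP hsum).comap f, ?_⟩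
  rw [ncard_edgeSet_comap, ncard_edgeSet_thetaGraph hP]
  intro x y h
  obtain ⟨i, p, hp, t, -, h⟩ := (thetaGraph_adj hP).1 h
  have hx : x ∈ thetaVerts P := by
    simp only [pathEdge, Sym2.eq_iff] at h
    rcases h with ⟨rfl, -⟩ | ⟨rfl, -⟩ <;> exact pathVertex_mem_thetaVerts hp
  exact ⟨(thetaVerts P).equivFinOfCardEq hn ⟨x, hx⟩, by simp [f]⟩

lemma two_mul_sum_fin_affine (N a b : ℕ) :
    2 * ∑ j : Fin N, (a * j + b) + a * N = a * N ^ 2 + 2 * b * N := by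
  rw [Fin.sum_univ_eq_sum_range (fun j => a * j + b)]
  induction N with
  | zero => simp
  | succ N ih => rw [Finset.sum_range_succ]; linarith

/-- Blocks realising all cycle lengths from `5` to `108 * k`: cycles, theta graphs, and four paths
with common ends, followed by a pendant path of length `L`. -/
def blockLengths (k L : ℕ) :
    Fin (48 * k - 4) ⊕ Fin (3 * k) ⊕ Fin (3 * k) ⊕ Fin (8 * k) ⊕ Unit → Finset ℕ
  | .inl j => {2, (j : ℕ) + 3}
  | .inr (.inl j) => {2, 48 * k + 4 * j + 2}
  | .inr (.inr (.inl j)) => {24 * k + 2 * j, 24 * k + 2 * j + 1, 24 * k + 2 * j + 2}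
  | .inr (.inr (.inr (.inl j))) =>
    {30 * k + 3 * j, 30 * k + 3 * j + 1, 30 * k + 3 * j + 2, 30 * k + 3 * j + 4}
  | .inr (.inr (.inr (.inr _))) => {L}

lemma two_le_of_mem_blockLengths {k L : ℕ} (hL : 2 ≤ L) :
    ∀ i, ∀ p ∈ blockLengths k L i, 2 ≤ p := by
  rintro (⟨j, hj⟩ | ⟨j, hj⟩ | ⟨j, hj⟩ | ⟨j, hj⟩ | _) p hp <;>
    simp only [blockLengths, Finset.mem_insert, Finset.mem_singleton] at hp <;> omega

lemma blockLengths_sums_distinct (k L : ℕ) :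
    ∀ i j, ∀ p ∈ blockLengths k L i, ∀ r ∈ blockLengths k L i,
      ∀ p' ∈ blockLengths k L j, ∀ r' ∈ blockLengths k L j, p < r → p' < r' →
        p + r = p' + r' → i = j ∧ p = p' := by
  rintro (⟨i, hi⟩ | ⟨i, hi⟩ | ⟨i, hi⟩ | ⟨i, hi⟩ | _) (⟨j, hj⟩ | ⟨j, hj⟩ | ⟨j, hj⟩ | ⟨j, hj⟩ | _)
    p hp r hr p' hp' r' hr' hpr hpr' h <;>
  simp only [blockLengths, Finset.mem_insert, Finset.mem_singleton] at hp hr hp' hr' <;>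
  simp only [reduceCtorEq, false_and, Sum.inl.injEq, Sum.inr.injEq, Fin.mk.injEq, true_and] <;>
  omega

lemma sum_blockLengths {k : ℕ} (hk : 0 < k) (L : ℕ) :
    ∑ i, ∑ p ∈ blockLengths k L i, p + 10 = 2901 * k ^ 2 + 38 * k + L := by
  obtain ⟨N, hN⟩ : ∃ N, 48 * k = N + 4 := ⟨48 * k - 4, by omega⟩
  have h1 : ∀ j : ℕ, ∑ p ∈ ({2, j + 3} : Finset ℕ), p = 1 * j + 5 := by
    intro j
    rw [Finset.sum_pair (by omega)]; ring
  have h2 : ∀ j : ℕ, ∑ p ∈ ({2, 48 * k + 4 * j + 2} : Finset ℕ), p = 4 * j + (48 * k + 4) := by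
    intro j
    rw [Finset.sum_pair (by omega)]; ring
  have h3 : ∀ j : ℕ, ∑ p ∈ ({24 * k + 2 * j, 24 * k + 2 * j + 1, 24 * k + 2 * j + 2} : Finset ℕ), p
      = 6 * j + (72 * k + 3) := by
    intro j
    rw [Finset.sum_insert (by simp), Finset.sum_pair (by omega)]; ring
  have h4 : ∀ j : ℕ, ∑ p ∈ ({30 * k + 3 * j, 30 * k + 3 * j + 1, 30 * k + 3 * j + 2,
      30 * k + 3 * j + 4} : Finset ℕ), p = 12 * j + (120 * k + 7) := by
    intro j
    rw [Finset.sum_insert (by simp), Finset.sum_insert (by simp), Finset.sum_pair (by omega)]; ring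
  simp only [Fintype.sum_sum_type, blockLengths, h1, h2, h3, h4, Finset.sum_singleton,
    Finset.univ_unique]
  rw [show 48 * k - 4 = N by omega]
  have e1 := two_mul_sum_fin_affine N 1 5
  have e2 := two_mul_sum_fin_affine (3 * k) 4 (48 * k + 4)
  have e3 := two_mul_sum_fin_affine (3 * k) 6 (72 * k + 3)
  have e4 := two_mul_sum_fin_affine (8 * k) 12 (120 * k + 7)
  have : N ^ 2 + 8 * N + 16 = 2304 * k ^ 2 := by
    have := congrArg (· ^ 2) hN
    ring_nf at this ⊢
    omega
  linarith

lemma sum_blockLengths_eq {k L : ℕ} (hk : 0 < k) (hL : 2 ≤ L) :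
    ∑ i, ∑ p ∈ blockLengths k L i, p + 5 =
      (∑ i, (∑ p ∈ blockLengths k L i, (p - 1) + 1) + 1) + 81 * k := by
  have hcard : ∀ i, ∑ p ∈ blockLengths k L i, p =
      ∑ p ∈ blockLengths k L i, (p - 1) + (blockLengths k L i).card := by
    intro i
    rw [Finset.card_eq_sum_ones, ← Finset.sum_add_distrib]
    refine Finset.sum_congr rfl fun p hp => ?_
    have := two_le_of_mem_blockLengths hL i p hp
    omega
  have h : ∑ i, (blockLengths k L i).card + 7 = 143 * k := by
    have h1 : ∀ j : ℕ, ({2, j + 3} : Finset ℕ).card = 2 := fun j =>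
      Finset.card_pair (by omega)
    have h2 : ∀ j : ℕ, ({2, 48 * k + 4 * j + 2} : Finset ℕ).card = 2 := fun j =>
      Finset.card_pair (by omega)
    have h3 : ∀ j : ℕ,
        ({24 * k + 2 * j, 24 * k + 2 * j + 1, 24 * k + 2 * j + 2} : Finset ℕ).card = 3 := by
      intro j
      rw [Finset.card_insert_of_notMem (by simp), Finset.card_pair (by omega)]
    have h4 : ∀ j : ℕ, ({30 * k + 3 * j, 30 * k + 3 * j + 1, 30 * k + 3 * j + 2,
        30 * k + 3 * j + 4} : Finset ℕ).card = 4 := by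
      intro j
      rw [Finset.card_insert_of_notMem (by simp), Finset.card_insert_of_notMem (by simp),
        Finset.card_pair (by omega)]
    simp only [Fintype.sum_sum_type, blockLengths, h1, h2, h3, h4, Finset.card_singleton,
      Finset.sum_const, Finset.card_univ, Fintype.card_fin, Fintype.card_unit, smul_eq_mul]
    omega
  simp only [hcard, Finset.sum_add_distrib, Finset.sum_const, Finset.card_univ,
    Fintype.card_sum, Fintype.card_fin, Fintype.card_unit, smul_eq_mul]
  omega

/-- For all sufficiently large `n`, there is a simple graph on `n` vertices
with no repeated cycle lengths and strictly more than `n + (3/2) * √n` edges. -/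
theorem stmt_3 :
    ∃ N : ℕ, ∀ n : ℕ, N ≤ n →
      ∃ G : SimpleGraph (Fin n),
        NoRepeatedCycleLengths G ∧
        (n : ℝ) + (3 / 2 : ℝ) * Real.sqrt n < (G.edgeSet.ncard : ℝ) := by
  refine ⟨2901 * 1000 ^ 2, fun n hn => ?_⟩
  obtain ⟨k, hk1, hk2⟩ : ∃ k, 2901 * k ^ 2 ≤ n ∧ n < 2901 * (k + 1) ^ 2 := by
    refine ⟨Nat.sqrt (n / 2901), ?_, ?_⟩
    · have := Nat.sqrt_le' (n / 2901)
      omega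
    · have := Nat.lt_succ_sqrt' (n / 2901)
      rw [Nat.succ_eq_add_one] at this
      omega
  have hk : 1000 ≤ k := by
    by_contra! h
    have : (k + 1) ^ 2 ≤ 1000 ^ 2 := Nat.pow_le_pow_left h 2
    omega
  obtain ⟨L, hL⟩ : ∃ L, L + 2901 * k ^ 2 = n + 43 * k + 5 :=
    ⟨n + 43 * k + 5 - 2901 * k ^ 2, by omega⟩
  have hL2 : 2 ≤ L := by omega
  have hE := sum_blockLengths (by omega : 0 < k) L
  have hV := sum_blockLengths_eq (by omega : 0 < k) hL2
  obtain ⟨G, hG, hcard⟩ := exists_noRepeatedCycleLengths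
    (two_le_of_mem_blockLengths hL2) (blockLengths_sums_distinct k L) (n := n) (by omega)
  refine ⟨G, hG, ?_⟩
  have hm : G.edgeSet.ncard + 5 = n + 81 * k := by omega
  have hm' : (G.edgeSet.ncard : ℝ) = n + (81 * k - 5) := by
    have : (G.edgeSet.ncard : ℝ) + 5 = n + 81 * k := by exact_mod_cast hm
    linarith
  rw [hm']
  have hkR : (1000 : ℝ) ≤ k := by exact_mod_cast hk
  have hnR : (n : ℝ) < 2901 * (k + 1) ^ 2 := by exact_mod_cast hk2
  have hs : Real.sqrt n < 2 / 3 * (81 * k - 5) := by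
    rw [Real.sqrt_lt' (by linarith)]
    nlinarith
  linarith
end
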